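/- liminf_{n→∞} φ(ψ(n)) · log log n / n = e^{−γ}, where γ is the Euler–Mascheroni constant. -/

import Mathlib

open Filter Real

/-- The Dedekind `ψ` function: `ψ(n) = n * ∏_{p ∣ n} (1 + 1/p)`,
i.e. `ψ(p^a) = p^(a-1) * (p + 1)` multiplicatively. -/
def dedekindPsi (n : ℕ) : ℕ := n.factorization.prod fun p a => p ^ (a - 1) * (p + 1)

section Mertens

open Finset ArithmeticFunction
open scoped Topology

/-- Mertens' first theorem for the von Mangoldt function. -/
theorem abs_sum_vonMangoldt_div_sub_log_le (N : ℕ) (hN : 1 ≤ N) :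
    |∑ n ∈ Ioc 0 N, vonMangoldt n / n - Real.log N| ≤ Real.log 4 + 5 := by
  have hNpos : (0 : ℝ) < N := by exact_mod_cast hN
  have h1 : Real.log (N.factorial) = ∑ n ∈ Ioc 0 N, vonMangoldt n * ((N / n : ℕ) : ℝ) := by
    have := sum_Ioc_mul_zeta_eq_sum (vonMangoldt : ArithmeticFunction ℝ) N
    rw [vonMangoldt_mul_zeta] at this
    have hI : Finset.Ico 1 (N + 1) = Finset.Ioc 0 N := by ext; simp; omega
    rw [← this, ← Finset.prod_Ico_id_eq_factorial, Nat.cast_prod, Real.log_prod, hI]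
    · simp
    · intro i hi
      have := (Finset.mem_Ico.mp hi).1
      positivity
  have h2 : Real.log N.factorial ≤ N * Real.log N := by
    rw [← Real.log_pow]
    exact Real.log_le_log (by positivity) (by exact_mod_cast N.factorial_le_pow)
  have h3 : N * Real.log N - N ≤ Real.log N.factorial := by
    have := Stirling.le_log_factorial_stirling (n := N) (by omega)
    have h4 : 0 ≤ Real.log N := Real.log_natCast_nonneg N
    have h5 : 0 ≤ Real.log (2 * Real.pi) := Real.log_nonneg (by nlinarith [Real.pi_gt_three])
    linarith
  have h4 : ∑ n ∈ Ioc 0 N, vonMangoldt n * ((N / n : ℕ) : ℝ)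
      ≤ N * ∑ n ∈ Ioc 0 N, vonMangoldt n / n := by
    rw [Finset.mul_sum]
    refine Finset.sum_le_sum fun n hn => ?_
    calc vonMangoldt n * ((N / n : ℕ) : ℝ) ≤ vonMangoldt n * ((N : ℝ) / n) := by
          gcongr
          exact Nat.cast_div_le
      _ = _ := by ring
  have h5 : N * ∑ n ∈ Ioc 0 N, vonMangoldt n / n
      ≤ ∑ n ∈ Ioc 0 N, vonMangoldt n * ((N / n : ℕ) : ℝ) + (Real.log 4 + 4) * N := by
    have h6 := Chebyshev.psi_le_const_mul_self (x := (N : ℝ)) hNpos.le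
    simp only [Chebyshev.psi, Nat.floor_natCast] at h6
    refine le_trans ?_ (add_le_add_right h6 _)
    rw [Finset.mul_sum, ← Finset.sum_add_distrib]
    refine Finset.sum_le_sum fun n hn => ?_
    have hn0 : 0 < n := (Finset.mem_Ioc.mp hn).1
    have h7 : (N : ℝ) / n ≤ ((N / n : ℕ) : ℝ) + 1 := by
      rw [← Nat.floor_div_eq_div (K := ℝ)]
      exact (Nat.lt_floor_add_one _).le
    calc N * (vonMangoldt n / n) = vonMangoldt n * ((N : ℝ) / n) := by ring
      _ ≤ vonMangoldt n * (((N / n : ℕ) : ℝ) + 1) := by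
          gcongr
      _ = _ := by ring
  rw [← h1] at h4 h5
  set S := ∑ n ∈ Ioc 0 N, vonMangoldt n / n
  have hlog : 0 ≤ Real.log 4 := Real.log_nonneg (by norm_num)
  rw [abs_le]
  constructor
  · by_contra hc
    push Not at hc
    nlinarith [mul_lt_mul_of_pos_left hc hNpos]
  · by_contra hc
    push Not at hc
    nlinarith [mul_lt_mul_of_pos_left hc hNpos]

theorem vonMangoldt_residueClass_one_eq (n : ℕ) :
    vonMangoldt.residueClass (1 : ZMod 1) n = vonMangoldt n := by
  simp [vonMangoldt.residueClass, Subsingleton.elim (n : ZMod 1) 1]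

/-- Mertens' first theorem. -/
theorem exists_abs_sum_log_prime_div_sub_log_le :
    ∃ C : ℝ, ∀ N : ℕ, 1 ≤ N → |∑ p ∈ Ioc 0 N with p.Prime, Real.log p / p - Real.log N| ≤ C := by
  have hs := vonMangoldt.summable_residueClass_non_primes_div (a := (1 : ZMod 1))
  simp only [vonMangoldt_residueClass_one_eq] at hs
  set f : ℕ → ℝ := fun n => (if n.Prime then 0 else vonMangoldt n) / n with hf
  have hf0 : ∀ n, 0 ≤ f n := by
    intro n
    simp only [hf]
    split_ifs
    · simp
    · exact div_nonneg vonMangoldt_nonneg (Nat.cast_nonneg _)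
  refine ⟨Real.log 4 + 5 + ∑' n, f n, fun N hN => ?_⟩
  have h1 := abs_sum_vonMangoldt_div_sub_log_le N hN
  have h2 : ∑ n ∈ Ioc 0 N, vonMangoldt n / n
      = ∑ p ∈ Ioc 0 N with p.Prime, Real.log p / p + ∑ n ∈ Ioc 0 N, f n := by
    rw [Finset.sum_filter, ← Finset.sum_add_distrib]
    refine Finset.sum_congr rfl fun n _ => ?_
    simp only [hf]
    split_ifs with h
    · simp [vonMangoldt_apply_prime h]
    · simp
  have h3 : ∑ n ∈ Ioc 0 N, f n ≤ ∑' n, f n := hs.sum_le_tsum _ fun n _ => hf0 n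
  have h4 : 0 ≤ ∑ n ∈ Ioc 0 N, f n := Finset.sum_nonneg fun n _ => hf0 n
  rw [h2] at h1
  rw [abs_le] at h1 ⊢
  constructor <;> linarith [h1.1, h1.2]

end Mertens

section MertensBlocks

open Finset
open scoped Topology

/-- The contribution `-log (1 - 1/p)` of a prime `p` to the logarithm of Mertens' product,
extended by zero to all natural numbers. -/
noncomputable def mertensWeight (n : ℕ) : ℝ := if n.Prime then -Real.log (1 - (n : ℝ)⁻¹) else 0

theorem abs_neg_log_one_sub_sub_le {u : ℝ} (hu : 0 ≤ u) (hu' : u ≤ 1 / 2) :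
    |-Real.log (1 - u) - u| ≤ 2 * u ^ 2 := by
  have h := Real.abs_log_sub_add_sum_range_le (x := u) (by rw [abs_of_nonneg hu]; linarith) 1
  simp only [Finset.range_one, Finset.sum_singleton, abs_of_nonneg hu] at h
  norm_num at h
  have h2 : u ^ 2 / (1 - u) ≤ 2 * u ^ 2 := by
    rw [div_le_iff₀ (by linarith)]
    nlinarith [sq_nonneg u]
  rw [← abs_neg]
  calc |-(-Real.log (1 - u) - u)| = |u + Real.log (1 - u)| := by ring_nf
    _ ≤ _ := h.trans h2

theorem le_neg_log_one_sub {u : ℝ} (hu' : u < 1) : u ≤ -Real.log (1 - u) := by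
  have := Real.log_le_sub_one_of_pos (x := 1 - u) (by linarith)
  linarith

theorem inv_prime_le_half {p : ℕ} (hp : p.Prime) : ((p : ℝ)⁻¹) ≤ 1 / 2 := by
  rw [one_div]
  exact inv_anti₀ (by norm_num) (by exact_mod_cast hp.two_le)

theorem mertensWeight_nonneg (n : ℕ) : 0 ≤ mertensWeight n := by
  rw [mertensWeight]
  split_ifs with h
  · have h1 := inv_prime_le_half h
    have h2 := le_neg_log_one_sub (u := (n : ℝ)⁻¹) (by linarith)
    have h3 : (0 : ℝ) ≤ (n : ℝ)⁻¹ := by positivity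
    linarith
  · exact le_rfl

/-- The integers `n` with `exp k < n ≤ exp (k + 1)`. -/
noncomputable def expBlock (k : ℕ) : Finset ℕ := Ioc ⌊Real.exp k⌋₊ ⌊Real.exp (k + 1 : ℕ)⌋₊

theorem mem_expBlock {k n : ℕ} (hn : n ∈ expBlock k) :
    0 < n ∧ (k : ℝ) < Real.log n ∧ Real.log n ≤ k + 1 := by
  rw [expBlock, Finset.mem_Ioc] at hn
  have h1 : Real.exp k < n := Nat.lt_of_floor_lt hn.1
  have h2 : (n : ℝ) ≤ Real.exp (k + 1 : ℕ) :=
    (Nat.le_floor_iff (Real.exp_pos _).le).mp hn.2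
  have h0 : (0 : ℝ) < n := (Real.exp_pos _).trans h1
  refine ⟨by exact_mod_cast h0, (Real.lt_log_iff_exp_lt h0).mpr h1, ?_⟩
  have := (Real.log_le_iff_le_exp h0).mpr h2
  exact_mod_cast this

theorem sum_range_sum_expBlock (f : ℕ → ℝ) (K : ℕ) :
    ∑ k ∈ range K, ∑ n ∈ expBlock k, f n = ∑ n ∈ Ioc 1 ⌊Real.exp K⌋₊, f n := by
  induction K with
  | zero => simp
  | succ K ih =>
    rw [Finset.sum_range_succ, ih, expBlock, Finset.sum_Ioc_consecutive]
    · exact Nat.le_floor (by simp)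
    · exact Nat.floor_mono (Real.exp_le_exp.mpr (by push_cast; linarith))

theorem sum_Ioc_one_eq_sum_Ioc_zero {f : ℕ → ℝ} (hf : f 1 = 0) (N : ℕ) :
    ∑ n ∈ Ioc 1 N, f n = ∑ n ∈ Ioc 0 N, f n := by
  refine Finset.sum_subset (Finset.Ioc_subset_Ioc_left (by norm_num)) fun n hn hn' => ?_
  simp only [Finset.mem_Ioc, not_and, not_le] at hn hn'
  have : n = 1 := by omega
  rw [this, hf]

theorem exists_abs_sum_expBlock_log_prime_div_sub_le :
    ∃ C : ℝ, ∀ K : ℕ,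
      |∑ k ∈ range K, (∑ n ∈ expBlock k, (if n.Prime then Real.log n / n else 0) - 1)| ≤ C := by
  obtain ⟨C, hC⟩ := exists_abs_sum_log_prime_div_sub_log_le
  refine ⟨C + 1, fun K => ?_⟩
  rw [Finset.sum_sub_distrib, sum_range_sum_expBlock, sum_Ioc_one_eq_sum_Ioc_zero (by simp),
    ← Finset.sum_filter]
  simp only [Finset.sum_const, Finset.card_range, nsmul_eq_mul, mul_one]
  have h1 : 1 ≤ ⌊Real.exp K⌋₊ := Nat.le_floor (by simp)
  have h2 := hC _ h1
  have h3 : Real.log ⌊Real.exp K⌋₊ ≤ K := by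
    rw [Real.log_le_iff_le_exp (by exact_mod_cast h1)]
    exact Nat.floor_le (Real.exp_pos _).le
  have h4 : (K : ℝ) - 1 ≤ Real.log ⌊Real.exp K⌋₊ := by
    rw [Real.le_log_iff_exp_le (by exact_mod_cast h1), Real.exp_sub,
      div_le_iff₀ (Real.exp_pos _)]
    have h5 := Nat.lt_floor_add_one (Real.exp K)
    have h6 : (1 : ℝ) ≤ ⌊Real.exp K⌋₊ := by exact_mod_cast h1
    nlinarith [Real.add_one_le_exp 1]
  rw [abs_le] at h2 ⊢
  constructor <;> linarith [h2.1, h2.2]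

/-- Block form of Mertens' second theorem: comparing the blocks `exp k < p ≤ exp (k + 1)` with the
harmonic series gives a convergent series. -/
theorem exists_tendsto_sum_expBlock_mertensWeight_sub :
    ∃ D : ℝ, Tendsto (fun K : ℕ => ∑ k ∈ range K,
      (∑ n ∈ expBlock k, mertensWeight n - 1 / ((k : ℝ) + 1))) atTop (𝓝 D) := by
  obtain ⟨C, hC⟩ := exists_abs_sum_expBlock_log_prime_div_sub_le
  set m : ℕ → ℝ := fun k => ∑ n ∈ expBlock k, (if n.Prime then Real.log n / n else 0) with hm
  set c : ℕ → ℝ := fun k => ∑ n ∈ expBlock k, mertensWeight n with hc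
  have hm_le (k : ℕ) : m k ≤ 2 * C + 1 := by
    have h1 := (abs_le.mp (hC (k + 1))).2
    have h2 := (abs_le.mp (hC k)).1
    rw [Finset.sum_range_succ] at h1
    simp only [hm]
    linarith
  have hcauchy : CauchySeq fun K => ∑ k ∈ range K, (1 / ((k : ℝ) + 1)) • (m k - 1) := by
    refine Antitone.cauchySeq_series_mul_of_tendsto_zero_of_bounded (b := C) ?_
      tendsto_one_div_add_atTop_nhds_zero_nat hC
    intro a b hab
    have : (a : ℝ) ≤ b := by exact_mod_cast hab
    exact one_div_le_one_div_of_le (by positivity) (by linarith)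
  obtain ⟨D₁, hD₁⟩ := cauchySeq_tendsto_of_complete hcauchy
  set g : ℕ → ℝ := fun k => c k - m k / (k + 1) with hg
  have hg_eq (k : ℕ) : g k = ∑ n ∈ expBlock k,
      (mertensWeight n - (if n.Prime then Real.log n / n else 0) / (k + 1)) := by
    simp only [hg, hc, hm]
    rw [Finset.sum_sub_distrib, Finset.sum_div]
  have hg0 (k : ℕ) : 0 ≤ g k := by
    rw [hg_eq]
    refine Finset.sum_nonneg fun n hn => ?_
    obtain ⟨hn0, -, hn2⟩ := mem_expBlock hn
    rw [mertensWeight]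
    split_ifs with h
    · have h1 := inv_prime_le_half h
      have h2 := le_neg_log_one_sub (u := (n : ℝ)⁻¹) (by linarith)
      have h3 : Real.log n / n / (k + 1) ≤ (n : ℝ)⁻¹ := by
        rw [div_le_iff₀ (by positivity), div_eq_mul_inv, mul_comm]
        exact mul_le_mul_of_nonneg_left hn2 (by positivity)
      linarith
    · simp
  have hg1 (k : ℕ) : g k ≤ 2 * (2 * C + 1) * (1 / ((k : ℝ) + 1) ^ 2) +
      ∑ n ∈ expBlock k, 2 * (1 / (n : ℝ) ^ 2) := by
    have h1 : g k ≤ ∑ n ∈ expBlock k, (2 / ((k : ℝ) + 1) ^ 2 *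
        (if n.Prime then Real.log n / n else 0) + 2 * (1 / (n : ℝ) ^ 2)) := by
      rw [hg_eq]
      refine Finset.sum_le_sum fun n hn => ?_
      obtain ⟨hn0, hn1, hn2⟩ := mem_expBlock hn
      rw [mertensWeight]
      split_ifs with h
      · have h1 := inv_prime_le_half h
        have h2 := (abs_le.mp (abs_neg_log_one_sub_sub_le (u := (n : ℝ)⁻¹) (by positivity) h1)).2
        have h3 : (n : ℝ)⁻¹ - Real.log n / n / (k + 1)
            ≤ 2 / ((k : ℝ) + 1) ^ 2 * (Real.log n / n) := by
          have hL : ((k : ℝ) + 1) / 2 ≤ Real.log n := by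
            rcases Nat.eq_zero_or_pos k with hk | hk
            · subst hk
              have : Real.log 2 ≤ Real.log n :=
                Real.log_le_log (by norm_num) (by exact_mod_cast h.two_le)
              have := Real.log_two_gt_d9
              norm_num
              linarith
            · have : (1 : ℝ) ≤ k := by exact_mod_cast hk
              linarith
          have hn0' : (0 : ℝ) < n := by exact_mod_cast hn0
          have hk1 : (0 : ℝ) < (k : ℝ) + 1 := by positivity
          have e1 : (n : ℝ)⁻¹ - Real.log n / n / (k + 1)
              = ((k + 1) * (k + 1 - Real.log n)) / (n * (k + 1) ^ 2) := by
            field_simp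
          have e2 : 2 / ((k : ℝ) + 1) ^ 2 * (Real.log n / n)
              = (2 * Real.log n) / (n * (k + 1) ^ 2) := by
            field_simp
          rw [e1, e2]
          exact div_le_div_of_nonneg_right (by nlinarith) (by positivity)
        have h4 : ((n : ℝ)⁻¹) ^ 2 = 1 / (n : ℝ) ^ 2 := by simp
        rw [← h4]
        linarith
      · simp
    refine h1.trans ?_
    rw [Finset.sum_add_distrib, ← Finset.mul_sum]
    refine add_le_add ?_ le_rfl
    calc 2 / ((k : ℝ) + 1) ^ 2 * m k ≤ 2 / ((k : ℝ) + 1) ^ 2 * (2 * C + 1) := by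
          exact mul_le_mul_of_nonneg_left (hm_le k) (by positivity)
      _ = _ := by ring
  have hs2 : Summable fun n : ℕ => 2 * (1 / (n : ℝ) ^ 2) :=
    (Real.summable_one_div_nat_pow.mpr (by norm_num)).mul_left 2
  have hsum_g : Summable g := by
    refine Summable.of_nonneg_of_le hg0 hg1 (Summable.add ?_ ?_)
    · refine Summable.mul_left _ ?_
      have := (summable_nat_add_iff 1).mpr
        (Real.summable_one_div_nat_pow (p := 2) |>.mpr (by norm_num))
      simpa using this
    · refine summable_of_sum_range_le (c := ∑' n : ℕ, 2 * (1 / (n : ℝ) ^ 2))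
        (fun k => Finset.sum_nonneg fun n _ => by positivity) fun K => ?_
      rw [sum_range_sum_expBlock]
      exact hs2.sum_le_tsum _ fun n _ => by positivity
  refine ⟨D₁ + ∑' k, g k, (hD₁.add hsum_g.hasSum.tendsto_sum_nat).congr fun K => ?_⟩
  rw [← Finset.sum_add_distrib]
  refine Finset.sum_congr rfl fun k _ => ?_
  simp only [hg, smul_eq_mul]
  ring

end MertensBlocks

section MertensConstant

open Finset
open scoped Topology

theorem log_riemannZeta_eq_tsum_prime {s : ℝ} (hs : 1 < s) :
    Real.log (riemannZeta (s : ℂ)).re =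
      ∑' n : ℕ, if n.Prime then -Real.log (1 - (n : ℝ) ^ (-s)) else 0 := by
  have h := riemannZeta_eulerProduct_exp_log (s := (s : ℂ)) (by simpa using hs)
  have h1 (p : Nat.Primes) : -Complex.log (1 - (p : ℂ) ^ (-(s : ℂ))) =
      ((-Real.log (1 - (p : ℝ) ^ (-s)) : ℝ) : ℂ) := by
    have h2 : ((p : ℕ) : ℝ) ^ (-s) < 1 :=
      Real.rpow_lt_one_of_one_lt_of_neg (by exact_mod_cast p.2.one_lt) (by linarith)
    rw [Complex.ofReal_neg, Complex.ofReal_log (by linarith), Complex.ofReal_sub,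
      Complex.ofReal_cpow (by positivity)]
    simp
  rw [tsum_congr h1, ← Complex.ofReal_tsum, ← Complex.ofReal_exp] at h
  rw [← h, Complex.ofReal_re, Real.log_exp]
  have h3 := tsum_subtype {n : ℕ | n.Prime} (fun n : ℕ => -Real.log (1 - (n : ℝ) ^ (-s)))
  refine (Eq.trans ?_ h3).trans (tsum_congr fun n => ?_)
  · rfl
  · simp [Set.indicator_apply]

theorem summable_mertensWeight_mul_rpow {η : ℝ} (hη : 0 < η) :
    Summable fun n : ℕ => mertensWeight n * (n : ℝ) ^ (-η) := by
  refine Summable.of_nonneg_of_le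
    (fun n => mul_nonneg (mertensWeight_nonneg n) (by positivity)) (fun n => ?_)
    ((Real.summable_nat_rpow (p := -(1 + η)).mpr (by linarith)).mul_left 2)
  rw [mertensWeight]
  split_ifs with h
  · have h1 := inv_prime_le_half h
    have h0 : (0 : ℝ) < n := by exact_mod_cast h.pos
    have h2 := (abs_le.mp (abs_neg_log_one_sub_sub_le (u := (n : ℝ)⁻¹) (by positivity) h1)).2
    have h3 : (n : ℝ) ^ (-(1 + η)) = (n : ℝ)⁻¹ * (n : ℝ) ^ (-η) := by
      rw [neg_add, Real.rpow_add h0, Real.rpow_neg_one]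
    rw [h3, ← mul_assoc]
    refine mul_le_mul_of_nonneg_right ?_ (by positivity)
    have h4 : (0 : ℝ) ≤ (n : ℝ)⁻¹ := by positivity
    nlinarith
  · simp only [zero_mul]
    positivity

theorem tendsto_tsum_mertensWeight_mul_rpow_add_log :
    Tendsto (fun η : ℝ => ∑' n : ℕ, mertensWeight n * (n : ℝ) ^ (-η) + Real.log η)
      (𝓝[>] 0) (𝓝 0) := by
  have hz : Tendsto (fun η : ℝ => Real.log (riemannZeta ((1 + η : ℝ) : ℂ)).re + Real.log η)
      (𝓝[>] 0) (𝓝 0) := by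
    have h := log_riemannZeta_add_log_sub_isLittleO_ofReal.tendsto_div_nhds_zero
    have h2 : Tendsto (fun η : ℝ => 1 + η) (𝓝[>] 0) (𝓝[>] 1) := by
      refine tendsto_nhdsWithin_iff.mpr ⟨?_, ?_⟩
      · have : Tendsto (fun η : ℝ => 1 + η) (𝓝 0) (𝓝 (1 + 0)) :=
          tendsto_const_nhds.add tendsto_id
        rw [add_zero] at this
        exact this.mono_left nhdsWithin_le_nhds
      · filter_upwards [self_mem_nhdsWithin] with η hη
        simpa using hη
    refine (h.comp h2).congr fun η => ?_
    simp
  set d : ℝ → ℕ → ℝ := fun η n => mertensWeight n * (n : ℝ) ^ (-η) -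
    (if n.Prime then -Real.log (1 - (n : ℝ) ^ (-(1 + η))) else 0) with hd
  have hd_bound {η : ℝ} (hη : 0 < η) (n : ℕ) : ‖d η n‖ ≤ 4 * (1 / (n : ℝ) ^ 2) := by
    simp only [hd, mertensWeight, Real.norm_eq_abs]
    split_ifs with h
    · have h1 := inv_prime_le_half h
      have h0 : (0 : ℝ) < n := by exact_mod_cast h.pos
      have h5 : (n : ℝ) ^ (-η) ≤ 1 :=
        Real.rpow_le_one_of_one_le_of_nonpos (by exact_mod_cast h.one_le) (by linarith)
      have h6 : (0 : ℝ) < (n : ℝ) ^ (-η) := by positivity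
      have h3 : (n : ℝ) ^ (-(1 + η)) = (n : ℝ)⁻¹ * (n : ℝ) ^ (-η) := by
        rw [neg_add, Real.rpow_add h0, Real.rpow_neg_one]
      have h4 : (0 : ℝ) < (n : ℝ)⁻¹ := by positivity
      have h7 : (n : ℝ)⁻¹ * (n : ℝ) ^ (-η) ≤ (n : ℝ)⁻¹ := mul_le_of_le_one_right h4.le h5
      have h2 := abs_le.mp (abs_neg_log_one_sub_sub_le (u := (n : ℝ)⁻¹) (by positivity) h1)
      have h8 := abs_le.mp (abs_neg_log_one_sub_sub_le (u := (n : ℝ)⁻¹ * (n : ℝ) ^ (-η))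
        (by positivity) (h7.trans h1))
      have h9 : ((n : ℝ)⁻¹ * (n : ℝ) ^ (-η)) ^ 2 ≤ ((n : ℝ)⁻¹) ^ 2 := by gcongr
      have h10 : 1 / (n : ℝ) ^ 2 = ((n : ℝ)⁻¹) ^ 2 := by simp
      rw [h3, h10, abs_le]
      have h11 : -(2 * ((n : ℝ)⁻¹) ^ 2) ≤
          (-Real.log (1 - (n : ℝ)⁻¹) - (n : ℝ)⁻¹) * (n : ℝ) ^ (-η) := by
        nlinarith [h2.1, sq_nonneg ((n : ℝ)⁻¹)]
      have h12 : (-Real.log (1 - (n : ℝ)⁻¹) - (n : ℝ)⁻¹) * (n : ℝ) ^ (-η) ≤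
          2 * ((n : ℝ)⁻¹) ^ 2 := by
        nlinarith [h2.2, sq_nonneg ((n : ℝ)⁻¹)]
      constructor <;> nlinarith [h8.1, h8.2]
    · simp
  have hs4 : Summable fun n : ℕ => 4 * (1 / (n : ℝ) ^ 2) :=
    (Real.summable_one_div_nat_pow.mpr (by norm_num)).mul_left 4
  have hd_tendsto : Tendsto (fun η => ∑' n, d η n) (𝓝[>] 0) (𝓝 (∑' _ : ℕ, 0)) := by
    refine tendsto_tsum_of_dominated_convergence hs4 (fun n => ?_) ?_
    · by_cases h : n.Prime
      · have h0 : (n : ℝ) ≠ 0 := by exact_mod_cast h.ne_zero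
        have h1 := inv_prime_le_half h
        have hc : ContinuousAt (fun η => d η n) 0 := by
          simp only [hd, h, if_true]
          have : (1 : ℝ) - (n : ℝ) ^ (-(1 + (0 : ℝ))) ≠ 0 := by
            rw [add_zero, Real.rpow_neg_one]; linarith
          fun_prop (disch := first | assumption | simp [h0])
        have h3 : d 0 n = 0 := by simp [hd, h, mertensWeight, Real.rpow_neg_one]
        have := hc.tendsto
        rw [h3] at this
        exact this.mono_left nhdsWithin_le_nhds
      · simp [hd, h, mertensWeight]
    · filter_upwards [self_mem_nhdsWithin] with η hη n using hd_bound hη n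
  rw [tsum_zero] at hd_tendsto
  have := hd_tendsto.add hz
  rw [add_zero] at this
  refine this.congr' ?_
  filter_upwards [self_mem_nhdsWithin] with η hη
  have hη' : (0 : ℝ) < η := hη
  have hsd : Summable (d η) := Summable.of_norm_bounded hs4 (hd_bound hη')
  have hsw := summable_mertensWeight_mul_rpow hη'
  have hse : Summable fun n : ℕ =>
      if n.Prime then -Real.log (1 - (n : ℝ) ^ (-(1 + η))) else 0 := by
    refine (hsw.sub hsd).congr fun n => ?_
    simp only [hd]
    ring
  rw [log_riemannZeta_eq_tsum_prime (by linarith), ← add_assoc, hsw.tsum_sub hse]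
  ring

end MertensConstant

section MertensLimit

open Finset
open scoped Topology

theorem sum_expBlock_mertensWeight_mul_rpow_bounds {x : ℝ} (hx0 : 0 < x) (hx1 : x < 1) (k : ℕ) :
    x * ((∑ n ∈ expBlock k, mertensWeight n) * x ^ k) ≤
        ∑ n ∈ expBlock k, mertensWeight n * (n : ℝ) ^ (Real.log x) ∧
      ∑ n ∈ expBlock k, mertensWeight n * (n : ℝ) ^ (Real.log x) ≤
        (∑ n ∈ expBlock k, mertensWeight n) * x ^ k := by
  have hl : Real.log x < 0 := Real.log_neg hx0 hx1
  have hpow (j : ℕ) : x ^ j = Real.exp (Real.log x * j) := by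
    rw [mul_comm, Real.exp_nat_mul, Real.exp_log hx0]
  constructor
  · rw [mul_comm, mul_assoc, ← pow_succ, Finset.sum_mul]
    refine Finset.sum_le_sum fun n hn => mul_le_mul_of_nonneg_left ?_ (mertensWeight_nonneg n)
    obtain ⟨h0, h1, h2⟩ := mem_expBlock hn
    rw [hpow, Real.rpow_def_of_pos (by exact_mod_cast h0), Real.exp_le_exp]
    push_cast
    nlinarith
  · rw [Finset.sum_mul]
    refine Finset.sum_le_sum fun n hn => mul_le_mul_of_nonneg_left ?_ (mertensWeight_nonneg n)
    obtain ⟨h0, h1, h2⟩ := mem_expBlock hn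
    rw [hpow, Real.rpow_def_of_pos (by exact_mod_cast h0), Real.exp_le_exp]
    nlinarith

theorem mertensWeight_one : mertensWeight 1 = 0 := by simp [mertensWeight]

theorem mertensWeight_zero : mertensWeight 0 = 0 := by simp [mertensWeight]

theorem tendsto_floor_exp_natCast : Tendsto (fun K : ℕ => ⌊Real.exp K⌋₊) atTop atTop :=
  tendsto_nat_floor_atTop.comp (Real.tendsto_exp_atTop.comp tendsto_natCast_atTop_atTop)

theorem tendsto_sum_expBlock_mertensWeight_mul_rpow {η : ℝ} (hη : 0 < η) :
    Tendsto (fun K : ℕ => ∑ k ∈ range K, ∑ n ∈ expBlock k, mertensWeight n * (n : ℝ) ^ (-η))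
      atTop (𝓝 (∑' n : ℕ, mertensWeight n * (n : ℝ) ^ (-η))) := by
  have h := (summable_mertensWeight_mul_rpow hη).hasSum.tendsto_sum_nat
  refine (h.comp ((tendsto_add_atTop_nat 1).comp tendsto_floor_exp_natCast)).congr fun K => ?_
  rw [sum_range_sum_expBlock, sum_Ioc_one_eq_sum_Ioc_zero (by simp [mertensWeight_one])]
  symm
  refine Finset.sum_subset (fun n hn => ?_) fun n hn hn' => ?_
  · simp only [Finset.mem_Ioc, Function.comp_apply, Finset.mem_range] at hn ⊢
    omega
  · simp only [Finset.mem_Ioc, Function.comp_apply, Finset.mem_range] at hn hn'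
    have : n = 0 := by omega
    simp [this, mertensWeight_zero]

theorem hasSum_one_div_add_one_mul_pow {x : ℝ} (hx0 : 0 < x) (hx1 : x < 1) :
    HasSum (fun k : ℕ => 1 / ((k : ℝ) + 1) * x ^ k) (-Real.log (1 - x) / x) := by
  have h := (Real.hasSum_pow_div_log_of_abs_lt_one (x := x)
    (by rw [abs_of_pos hx0]; exact hx1)).div_const x
  refine h.congr_fun fun k => ?_
  field_simp
  ring

theorem tendsto_log_one_sub_sub_log_neg_log :
    Tendsto (fun x : ℝ => Real.log (1 - x) - Real.log (-Real.log x)) (𝓝[<] 1) (𝓝 0) := by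
  have hlog : Tendsto Real.log (𝓝[<] 1) (𝓝 0) := by
    have := (Real.continuousAt_log one_ne_zero).tendsto
    rw [Real.log_one] at this
    exact this.mono_left nhdsWithin_le_nhds
  have hev : ∀ᶠ x : ℝ in 𝓝[<] 1, 0 < x :=
    (eventually_gt_nhds one_pos).filter_mono nhdsWithin_le_nhds
  refine tendsto_of_tendsto_of_tendsto_of_le_of_le' hlog tendsto_const_nhds ?_ ?_
  · filter_upwards [self_mem_nhdsWithin, hev] with x hx1 hx0
    have hx1 : x < 1 := hx1
    have h1 : -Real.log x ≤ (1 - x) / x := by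
      have := Real.one_sub_inv_le_log_of_pos hx0
      have h2 : (1 - x) / x = x⁻¹ - 1 := by field_simp
      linarith
    have h2 := Real.log_le_log (neg_pos.mpr (Real.log_neg hx0 hx1)) h1
    rw [Real.log_div (by linarith) hx0.ne'] at h2
    linarith
  · filter_upwards [self_mem_nhdsWithin, hev] with x hx1 hx0
    have hx1 : x < 1 := hx1
    have := Real.log_le_log (x := 1 - x) (y := -Real.log x) (by linarith)
      (by linarith [Real.log_le_sub_one_of_pos hx0])
    linarith

theorem tendsto_sum_expBlock_mertensWeight_sub :
    Tendsto (fun K : ℕ => ∑ k ∈ range K,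
      (∑ n ∈ expBlock k, mertensWeight n - 1 / ((k : ℝ) + 1))) atTop (𝓝 0) := by
  obtain ⟨D, hD⟩ := exists_tendsto_sum_expBlock_mertensWeight_sub
  suffices h0 : D = 0 by rwa [h0] at hD
  set u : ℕ → ℝ := fun k => ∑ n ∈ expBlock k, mertensWeight n - 1 / ((k : ℝ) + 1) with hu
  have hU := Real.tendsto_tsum_powerSeries_nhdsWithin_lt hD
  set U : ℝ → ℝ := fun x => ∑' k, u k * x ^ k with hUdef
  set N : ℝ → ℝ := fun η => ∑' n : ℕ, mertensWeight n * (n : ℝ) ^ (-η) with hN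
  have hid : Tendsto (fun x : ℝ => x) (𝓝[<] 1) (𝓝 1) := nhdsWithin_le_nhds
  have hpos : ∀ᶠ x : ℝ in 𝓝[<] 1, 0 < x :=
    (eventually_gt_nhds one_pos).filter_mono nhdsWithin_le_nhds
  have hNlog : Tendsto (fun x => N (-Real.log x) + Real.log (-Real.log x)) (𝓝[<] 1) (𝓝 0) := by
    refine tendsto_tsum_mertensWeight_mul_rpow_add_log.comp (tendsto_nhdsWithin_iff.mpr ⟨?_, ?_⟩)
    · have := (Real.continuousAt_log one_ne_zero).neg.tendsto
      rw [Pi.neg_apply, Real.log_one, neg_zero] at this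
      exact this.mono_left nhdsWithin_le_nhds
    · filter_upwards [self_mem_nhdsWithin, hpos] with x hx1 hx0
      exact neg_pos.mpr (Real.log_neg hx0 hx1)
  have hu_tendsto : Tendsto u atTop (𝓝 0) := by
    have h := (hD.comp (tendsto_add_atTop_nat 1)).sub hD
    rw [sub_self] at h
    refine h.congr fun k => ?_
    simp [Finset.sum_range_succ]
  have hu_summable {x : ℝ} (hx0 : 0 < x) (hx1 : x < 1) : Summable fun k => u k * x ^ k := by
    refine summable_of_isBigO_nat (summable_geometric_of_lt_one hx0.le hx1) ?_
    simpa using (hu_tendsto.isBigO_one ℝ).mul (Asymptotics.isBigO_refl (fun k : ℕ => x ^ k) atTop)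
  have hsum {x : ℝ} (hx0 : 0 < x) (hx1 : x < 1) :
      HasSum (fun k : ℕ => (∑ n ∈ expBlock k, mertensWeight n) * x ^ k)
        (U x + -Real.log (1 - x) / x) := by
    refine ((hu_summable hx0 hx1).hasSum.add (hasSum_one_div_add_one_mul_pow hx0 hx1)).congr_fun
      fun k => ?_
    simp only [hu]
    ring
  have hlim {x : ℝ} (hx0 : 0 < x) (hx1 : x < 1) :=
    tendsto_sum_expBlock_mertensWeight_mul_rpow (neg_pos.mpr (Real.log_neg hx0 hx1))
  have hlower {x : ℝ} (hx0 : 0 < x) (hx1 : x < 1) :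
      x * (U x + -Real.log (1 - x) / x) ≤ N (-Real.log x) := by
    refine le_of_tendsto_of_tendsto' ((hsum hx0 hx1).tendsto_sum_nat.const_mul x)
      (hlim hx0 hx1) fun K => ?_
    rw [Finset.mul_sum, neg_neg]
    exact Finset.sum_le_sum fun k _ =>
      (sum_expBlock_mertensWeight_mul_rpow_bounds hx0 hx1 k).1
  have hupper {x : ℝ} (hx0 : 0 < x) (hx1 : x < 1) :
      N (-Real.log x) ≤ U x + -Real.log (1 - x) / x := by
    refine le_of_tendsto_of_tendsto' (hlim hx0 hx1) (hsum hx0 hx1).tendsto_sum_nat fun K => ?_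
    rw [neg_neg]
    exact Finset.sum_le_sum fun k _ =>
      (sum_expBlock_mertensWeight_mul_rpow_bounds hx0 hx1 k).2
  apply le_antisymm
  · have h1 : Tendsto (fun x : ℝ => x * U x - (Real.log (1 - x) - Real.log (-Real.log x)))
        (𝓝[<] 1) (𝓝 (1 * D - 0)) := (hid.mul hU).sub tendsto_log_one_sub_sub_log_neg_log
    rw [one_mul, sub_zero] at h1
    refine le_of_tendsto_of_tendsto h1 hNlog ?_
    filter_upwards [self_mem_nhdsWithin, hpos] with x hx1 hx0
    have h := hlower hx0 hx1
    rw [mul_add, mul_div_cancel₀ _ hx0.ne'] at h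
    linarith
  · have h2 : Tendsto (fun x : ℝ => (1 - x) * Real.log (1 - x)) (𝓝[<] 1) (𝓝 0) := by
      have hc : Continuous fun x : ℝ => (1 - x) * Real.log (1 - x) :=
        Real.continuous_mul_log.comp (continuous_const.sub continuous_id)
      have := hc.tendsto 1
      simp only [sub_self, zero_mul] at this
      exact this.mono_left nhdsWithin_le_nhds
    have h1 : Tendsto (fun x : ℝ => U x - (Real.log (1 - x) - Real.log (-Real.log x)) -
        (1 - x) * Real.log (1 - x) / x) (𝓝[<] 1) (𝓝 (D - 0 - 0 / 1)) :=
      (hU.sub tendsto_log_one_sub_sub_log_neg_log).sub (h2.div hid one_ne_zero)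
    rw [zero_div, sub_zero, sub_zero] at h1
    refine le_of_tendsto_of_tendsto hNlog h1 ?_
    filter_upwards [self_mem_nhdsWithin, hpos] with x hx1 hx0
    have h := hupper hx0 hx1
    have h3 : (1 - x) * Real.log (1 - x) / x = Real.log (1 - x) / x - Real.log (1 - x) := by
      field_simp
    rw [neg_div] at h
    linarith

/-- Logarithmic form of Mertens' third theorem. -/
theorem tendsto_sum_mertensWeight_sub_log_log :
    Tendsto (fun x : ℝ => ∑ n ∈ Ioc 0 ⌊x⌋₊, mertensWeight n - Real.log (Real.log x)) atTop
      (𝓝 Real.eulerMascheroniConstant) := by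
  have hK : Tendsto (fun K : ℕ => ∑ n ∈ Ioc 0 ⌊Real.exp K⌋₊, mertensWeight n - Real.log K) atTop
      (𝓝 Real.eulerMascheroniConstant) := by
    have h := tendsto_sum_expBlock_mertensWeight_sub.add Real.tendsto_harmonic_sub_log
    rw [zero_add] at h
    refine h.congr fun K => ?_
    rw [Finset.sum_sub_distrib, sum_range_sum_expBlock,
      sum_Ioc_one_eq_sum_Ioc_zero mertensWeight_one, harmonic]
    push_cast
    simp only [one_div]
    ring
  have hfl : Tendsto (fun x : ℝ => ⌊Real.log x⌋₊) atTop atTop :=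
    tendsto_nat_floor_atTop.comp Real.tendsto_log_atTop
  have hdiff : Tendsto (fun K : ℕ => Real.log ((K : ℝ) + 1) - Real.log K) atTop (𝓝 0) :=
    (Real.tendsto_log_comp_add_sub_log 1).comp tendsto_natCast_atTop_atTop
  have hlow := (hK.sub hdiff).comp hfl
  have hupp := ((hK.comp (tendsto_add_atTop_nat 1)).add hdiff).comp hfl
  rw [sub_zero] at hlow
  rw [add_zero] at hupp
  have hmono {a b : ℕ} (hab : a ≤ b) :
      ∑ n ∈ Ioc 0 a, mertensWeight n ≤ ∑ n ∈ Ioc 0 b, mertensWeight n :=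
    Finset.sum_le_sum_of_subset_of_nonneg (Finset.Ioc_subset_Ioc_right hab)
      fun n _ _ => mertensWeight_nonneg n
  refine tendsto_of_tendsto_of_tendsto_of_le_of_le' hlow hupp ?_ ?_
  · filter_upwards [eventually_ge_atTop (Real.exp 1)] with x hx
    have hx0 : 0 < x := (Real.exp_pos 1).trans_le hx
    have hl : 1 ≤ Real.log x := (Real.le_log_iff_exp_le hx0).mpr hx
    simp only [Function.comp_apply]
    have h1 := Nat.floor_le (zero_le_one.trans hl)
    have h2 := hmono (a := ⌊Real.exp ⌊Real.log x⌋₊⌋₊) (b := ⌊x⌋₊)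
      (Nat.floor_mono ((Real.le_log_iff_exp_le hx0).mp h1))
    have h3 : Real.log (Real.log x) ≤ Real.log (⌊Real.log x⌋₊ + 1) :=
      Real.log_le_log (by linarith) (Nat.lt_floor_add_one _).le
    linarith
  · filter_upwards [eventually_ge_atTop (Real.exp 1)] with x hx
    have hx0 : 0 < x := (Real.exp_pos 1).trans_le hx
    have hl : 1 ≤ Real.log x := (Real.le_log_iff_exp_le hx0).mpr hx
    simp only [Function.comp_apply]
    have h1 := Nat.floor_le (zero_le_one.trans hl)
    have h2 := hmono (a := ⌊x⌋₊) (b := ⌊Real.exp (⌊Real.log x⌋₊ + 1 : ℕ)⌋₊)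
      (Nat.floor_mono ((Real.log_le_iff_le_exp hx0).mp
        (by push_cast; exact (Nat.lt_floor_add_one _).le)))
    have h4 : (0 : ℝ) < ⌊Real.log x⌋₊ := by
      exact_mod_cast Nat.floor_pos.mpr hl
    have h3 : Real.log ⌊Real.log x⌋₊ ≤ Real.log (Real.log x) := Real.log_le_log h4 h1
    push_cast at h2 ⊢
    linarith

/-- Mertens' third theorem. -/
theorem tendsto_prod_one_sub_inv_prime_mul_log :
    Tendsto (fun x : ℝ => (∏ p ∈ Ioc 0 ⌊x⌋₊ with p.Prime, (1 - (p : ℝ)⁻¹)) * Real.log x) atTop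
      (𝓝 (Real.exp (-Real.eulerMascheroniConstant))) := by
  refine ((Real.continuous_exp.tendsto _).comp
    tendsto_sum_mertensWeight_sub_log_log.neg).congr' ?_
  filter_upwards [eventually_gt_atTop 1] with x hx
  have hl : 0 < Real.log x := Real.log_pos hx
  simp only [Function.comp_apply]
  rw [neg_sub, sub_eq_add_neg, Real.exp_add, Real.exp_log hl, mul_comm, ← Finset.sum_neg_distrib,
    Real.exp_sum, Finset.prod_filter]
  congr 1
  refine Finset.prod_congr rfl fun n _ => ?_
  rw [mertensWeight]
  split_ifs with h
  · rw [neg_neg, Real.exp_log]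
    linarith [inv_prime_le_half h]
  · simp

end MertensLimit

section LowerBound

open Finset
open scoped Topology

theorem le_dedekindPsi {n : ℕ} (hn : n ≠ 0) : n ≤ dedekindPsi n := by
  conv_lhs => rw [← Nat.prod_factorization_pow_eq_self hn]
  refine Finset.prod_le_prod' fun p hp => ?_
  have ha : n.factorization p ≠ 0 := Finsupp.mem_support_iff.mp hp
  calc p ^ n.factorization p = p ^ (n.factorization p - 1) * p := by
        rw [← pow_succ, Nat.sub_add_cancel (Nat.one_le_iff_ne_zero.mpr ha)]
    _ ≤ _ := Nat.mul_le_mul_left _ (Nat.le_succ p)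

theorem dedekindPsi_le_sq {n : ℕ} (hn : n ≠ 0) : dedekindPsi n ≤ n ^ 2 := by
  conv_rhs => rw [← Nat.prod_factorization_pow_eq_self hn]
  rw [dedekindPsi, Finsupp.prod, Finsupp.prod, ← Finset.prod_pow]
  refine Finset.prod_le_prod' fun p hp => ?_
  have ha : n.factorization p ≠ 0 := Finsupp.mem_support_iff.mp hp
  have hp2 : 2 ≤ p := (Nat.prime_of_mem_primeFactors hp).two_le
  calc p ^ (n.factorization p - 1) * (p + 1) ≤ p ^ (n.factorization p - 1) * p ^ 2 :=
        Nat.mul_le_mul_left _ (by nlinarith)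
    _ = p ^ (n.factorization p + 1) := by
        rw [← pow_add]; congr 1; omega
    _ ≤ (p ^ n.factorization p) ^ 2 := by
        rw [← pow_mul]
        exact Nat.pow_le_pow_right (by omega) (by omega)

theorem totient_div_eq_exp_sum_mertensWeight {m : ℕ} (hm : m ≠ 0) :
    (m.totient : ℝ) / m = Real.exp (-∑ p ∈ m.primeFactors, mertensWeight p) := by
  have h : (m.totient : ℝ) = m * ∏ p ∈ m.primeFactors, (1 - (p : ℝ)⁻¹) := by
    have h := congrArg (Rat.cast : ℚ → ℝ) (Nat.totient_eq_mul_prod_factors m)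
    push_cast at h
    exact h
  have hm' : (m : ℝ) ≠ 0 := by exact_mod_cast hm
  rw [h, mul_div_cancel_left₀ _ hm', ← Finset.sum_neg_distrib, Real.exp_sum]
  refine Finset.prod_congr rfl fun p hp => ?_
  have hp := Nat.prime_of_mem_primeFactors hp
  rw [mertensWeight, if_pos hp, neg_neg, Real.exp_log]
  linarith [inv_prime_le_half hp]

theorem mertensWeight_le_two_mul_inv (n : ℕ) : mertensWeight n ≤ 2 * (n : ℝ)⁻¹ := by
  rw [mertensWeight]
  split_ifs with h
  · have h1 := inv_prime_le_half h
    have h0 : (0 : ℝ) ≤ (n : ℝ)⁻¹ := by positivity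
    have h2 := (abs_le.mp (abs_neg_log_one_sub_sub_le h0 h1)).2
    nlinarith
  · positivity

theorem sum_primeFactors_mertensWeight_le {m : ℕ} (hm : 1 < Real.log m) :
    ∑ p ∈ m.primeFactors, mertensWeight p ≤
      ∑ p ∈ Ioc 0 ⌊Real.log m⌋₊, mertensWeight p + 2 / Real.log (Real.log m) := by
  have hm0 : m ≠ 0 := by
    rintro rfl
    simp at hm
    linarith
  set y := Real.log m with hy
  have hy0 : 0 < y := by linarith
  have hly : 0 < Real.log y := Real.log_pos hm
  rw [← Finset.sum_filter_add_sum_filter_not m.primeFactors (fun p : ℕ => (p : ℝ) ≤ y)]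
  refine add_le_add ?_ ?_
  · refine Finset.sum_le_sum_of_subset_of_nonneg (fun p hp => ?_)
      fun n _ _ => mertensWeight_nonneg n
    rw [Finset.mem_filter] at hp
    rw [Finset.mem_Ioc]
    exact ⟨(Nat.prime_of_mem_primeFactors hp.1).pos, Nat.le_floor hp.2⟩
  · set S := m.primeFactors.filter fun p : ℕ => ¬(p : ℝ) ≤ y with hS
    have hcard : (S.card : ℝ) * Real.log y ≤ y := by
      have h1 : ∏ p ∈ S, p ≤ m := by
        refine Nat.le_of_dvd (Nat.pos_of_ne_zero hm0) ?_
        exact (Finset.prod_dvd_prod_of_subset _ _ _ (Finset.filter_subset _ _)).trans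
          (Nat.prod_primeFactors_dvd m)
      have h2 : ∑ p ∈ S, Real.log y ≤ ∑ p ∈ S, Real.log p := by
        refine Finset.sum_le_sum fun p hp => Real.log_le_log hy0 ?_
        exact (not_le.mp (Finset.mem_filter.mp hp).2).le
      have h3 : ∑ p ∈ S, Real.log p = Real.log (∏ p ∈ S, p : ℕ) := by
        push_cast
        rw [Real.log_prod]
        intro p hp
        have := (Nat.prime_of_mem_primeFactors (Finset.mem_filter.mp hp).1).ne_zero
        exact_mod_cast this
      rw [Finset.sum_const, nsmul_eq_mul, h3] at h2
      refine h2.trans (Real.log_le_log ?_ (by exact_mod_cast h1))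
      exact_mod_cast Finset.prod_pos fun p hp =>
        (Nat.prime_of_mem_primeFactors (Finset.mem_filter.mp hp).1).pos
    calc ∑ p ∈ S, mertensWeight p ≤ ∑ p ∈ S, 2 / y := by
          refine Finset.sum_le_sum fun p hp => (mertensWeight_le_two_mul_inv p).trans ?_
          rw [div_eq_mul_inv]
          have := (not_le.mp (Finset.mem_filter.mp hp).2).le
          gcongr
      _ = S.card * (2 / y) := by rw [Finset.sum_const, nsmul_eq_mul]
      _ ≤ (y / Real.log y) * (2 / y) := by
          gcongr
          rwa [le_div_iff₀ hly]
      _ = 2 / Real.log y := by field_simp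

theorem eventually_le_totient_dedekindPsi_mul_log_log_div {c : ℝ}
    (hc : c < Real.exp (-Real.eulerMascheroniConstant)) :
    ∀ᶠ n : ℕ in atTop,
      c ≤ (Nat.totient (dedekindPsi n) : ℝ) * Real.log (Real.log n) / n := by
  have hcast : Tendsto (fun m : ℕ => Real.log m) atTop atTop :=
    Real.tendsto_log_atTop.comp tendsto_natCast_atTop_atTop
  have hll : Tendsto (fun m : ℕ => Real.log (Real.log m)) atTop atTop :=
    Real.tendsto_log_atTop.comp hcast
  set G : ℕ → ℝ := fun m =>
    Real.exp (-(∑ p ∈ Ioc 0 ⌊Real.log m⌋₊, mertensWeight p - Real.log (Real.log (Real.log m))) -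
      2 / Real.log (Real.log m)) * (1 - Real.log 2 / Real.log (Real.log m)) with hG
  have hGlim : Tendsto G atTop (𝓝 (Real.exp (-Real.eulerMascheroniConstant - 0) * (1 - 0))) := by
    refine Tendsto.mul ((Real.continuous_exp.tendsto _).comp (Tendsto.sub
      (tendsto_sum_mertensWeight_sub_log_log.comp hcast).neg ?_)) (Tendsto.sub ?_ ?_)
    · exact tendsto_const_nhds.div_atTop hll
    · exact tendsto_const_nhds
    · exact tendsto_const_nhds.div_atTop hll
  rw [sub_zero, sub_zero, mul_one] at hGlim
  have hψ : Tendsto dedekindPsi atTop atTop := by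
    refine tendsto_atTop_mono' _ ?_ tendsto_id
    filter_upwards [eventually_ne_atTop 0] with n hn using le_dedekindPsi hn
  filter_upwards [(hGlim.comp hψ).eventually (lt_mem_nhds hc), eventually_ne_atTop 0,
    hcast.eventually_gt_atTop 1, hll.eventually_gt_atTop 0,
    hψ.eventually (hcast.eventually_gt_atTop 1), hψ.eventually (hll.eventually_gt_atTop 0)]
    with n h1 hn0 hn1 hn2 hm1 hm2
  refine h1.le.trans ?_
  simp only [Function.comp_apply, hG]
  set m := dedekindPsi n with hm
  have hnm := le_dedekindPsi hn0
  rw [← hm] at hnm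
  have hm0 : m ≠ 0 := by omega
  have hnpos : (0 : ℝ) < n := by exact_mod_cast Nat.pos_of_ne_zero hn0
  have hmpos : (0 : ℝ) < m := by exact_mod_cast Nat.pos_of_ne_zero hm0
  have hlog : Real.log (Real.log m) - Real.log 2 ≤ Real.log (Real.log n) := by
    have h2 : Real.log m ≤ 2 * Real.log n := by
      have : ((m : ℕ) : ℝ) ≤ (n : ℝ) ^ 2 := by exact_mod_cast dedekindPsi_le_sq hn0
      calc Real.log m ≤ Real.log ((n : ℝ) ^ 2) := Real.log_le_log hmpos this
        _ = 2 * Real.log n := by rw [Real.log_pow]; norm_num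
    have h3 := Real.log_le_log (by linarith) h2
    rw [Real.log_mul two_ne_zero (by linarith)] at h3
    linarith
  have hsum := sum_primeFactors_mertensWeight_le hm1
  have hexp : Real.exp (-(∑ p ∈ Ioc 0 ⌊Real.log m⌋₊, mertensWeight p -
      Real.log (Real.log (Real.log m))) - 2 / Real.log (Real.log m)) ≤
      (m.totient : ℝ) / m * Real.log (Real.log m) := by
    rw [totient_div_eq_exp_sum_mertensWeight hm0]
    calc _ ≤ Real.exp (-∑ p ∈ m.primeFactors, mertensWeight p + Real.log (Real.log (Real.log m))) :=
          Real.exp_le_exp.mpr (by linarith)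
      _ = _ := by rw [Real.exp_add, Real.exp_log hm2]
  rcases le_or_gt (1 - Real.log 2 / Real.log (Real.log m)) 0 with h | h
  · refine (mul_nonpos_of_nonneg_of_nonpos (Real.exp_pos _).le h).trans ?_
    positivity
  · calc _ ≤ (m.totient : ℝ) / m * Real.log (Real.log m) *
          (1 - Real.log 2 / Real.log (Real.log m)) := mul_le_mul_of_nonneg_right hexp h.le
      _ = (m.totient : ℝ) / m * (Real.log (Real.log m) - Real.log 2) := by field_simp
      _ ≤ (m.totient : ℝ) / n * Real.log (Real.log n) := by
          gcongr
          have h4 : 1 - Real.log 2 / Real.log (Real.log m) =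
            (Real.log (Real.log m) - Real.log 2) / Real.log (Real.log m) := by field_simp
          rw [h4] at h
          exact ((div_pos_iff_of_pos_right hm2).mp h).le
      _ = _ := by ring

end LowerBound

section LFunctionBounds

open Finset MeasureTheory
open scoped Topology

theorem norm_sum_Icc_dirichletCharacter_le_natCast {q : ℕ} (χ : DirichletCharacter ℂ q) (N : ℕ) :
    ‖∑ k ∈ Icc 1 N, χ k‖ ≤ N := by
  calc _ ≤ ∑ k ∈ Icc 1 N, ‖χ k‖ := norm_sum_le _ _
    _ ≤ ∑ k ∈ Icc 1 N, 1 := Finset.sum_le_sum fun k _ => χ.norm_le_one _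
    _ = N := by simp

theorem sum_range_dirichletCharacter_add_eq_zero {q : ℕ} [NeZero q] {χ : DirichletCharacter ℂ q}
    (hχ : χ ≠ 1) (N : ℕ) : ∑ k ∈ range q, χ ((N + k : ℕ) : ZMod q) = 0 := by
  rw [← MulChar.sum_eq_zero_of_ne_one hχ]
  refine Finset.sum_bij (fun k _ => ((N + k : ℕ) : ZMod q)) (fun _ _ => Finset.mem_univ _)
    (fun a ha b hb hab => ?_) (fun b _ => ?_) (fun _ _ => rfl)
  · rw [Finset.mem_range] at ha hb
    rw [Nat.cast_add, Nat.cast_add, add_right_inj, ZMod.natCast_eq_natCast_iff'] at hab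
    rwa [Nat.mod_eq_of_lt ha, Nat.mod_eq_of_lt hb] at hab
  · refine ⟨(b - N).val, Finset.mem_range.mpr (ZMod.val_lt _), ?_⟩
    rw [Nat.cast_add, ZMod.natCast_zmod_val, add_sub_cancel]

theorem norm_sum_Icc_dirichletCharacter_le {q : ℕ} [NeZero q] {χ : DirichletCharacter ℂ q}
    (hχ : χ ≠ 1) (N : ℕ) : ‖∑ k ∈ Icc 1 N, χ k‖ ≤ q := by
  induction N using Nat.strong_induction_on with
  | _ N ih =>
    rcases lt_or_ge N q with h | h
    · exact (norm_sum_Icc_dirichletCharacter_le_natCast χ N).trans (by exact_mod_cast h.le)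
    · obtain ⟨M, rfl⟩ := Nat.exists_eq_add_of_le' h
      have h1 : ∑ k ∈ Icc 1 (M + q), χ k = ∑ k ∈ Icc 1 M, χ k := by
        rw [← Finset.Ico_add_one_right_eq_Icc, ← Finset.Ico_add_one_right_eq_Icc,
          ← Finset.sum_Ico_consecutive _ (Nat.le_add_left 1 M) (by omega : M + 1 ≤ M + q + 1),
          Finset.sum_Ico_eq_sum_range _ (M + 1)]
        rw [show M + q + 1 - (M + 1) = q by omega,
          sum_range_dirichletCharacter_add_eq_zero hχ (M + 1), add_zero]
      rw [h1]
      exact ih M (by have := NeZero.pos q; omega)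

theorem norm_sum_Icc_dirichletCharacter_le_rpow {q : ℕ} [NeZero q] {χ : DirichletCharacter ℂ q}
    (hχ : χ ≠ 1) {θ : ℝ} (hθ0 : 0 ≤ θ) (hθ1 : θ ≤ 1) {t : ℝ} (ht : 0 < t) :
    ‖∑ k ∈ Icc 1 ⌊t⌋₊, χ k‖ ≤ (q : ℝ) ^ θ * t ^ (1 - θ) := by
  set a := ‖∑ k ∈ Icc 1 ⌊t⌋₊, χ k‖ with ha
  have h1 : a ≤ q := norm_sum_Icc_dirichletCharacter_le hχ _
  have h2 : a ≤ t := (norm_sum_Icc_dirichletCharacter_le_natCast χ _).trans (Nat.floor_le ht.le)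
  have ha0 : 0 ≤ a := norm_nonneg _
  calc a = a ^ θ * a ^ (1 - θ) := by
        rw [← Real.rpow_add_of_nonneg ha0 hθ0 (by linarith)]; simp
    _ ≤ _ := mul_le_mul (Real.rpow_le_rpow ha0 h1 hθ0) (Real.rpow_le_rpow ha0 h2 (by linarith))
        (by positivity) (by positivity)

theorem dirichletCharacter_LFunction_eq_mul_mellin {q : ℕ} [NeZero q]
    {χ : DirichletCharacter ℂ q} (hχ : χ ≠ 1) {s : ℂ} (hs : 0 < s.re) :
    DirichletCharacter.LFunction χ s =
      s * mellin (fun t : ℝ => ∑ k ∈ Icc 1 ⌊t⌋₊, χ k) (-s) := by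
  set f : ℝ → ℂ := fun t => ∑ k ∈ Icc 1 ⌊t⌋₊, χ k with hf
  have hf0 {t : ℝ} (ht : t < 1) : f t = 0 := by
    simp only [hf]
    rw [Nat.floor_eq_zero.mpr ht]
    simp
  have hloc : LocallyIntegrableOn f (Set.Ioi 0) := by
    have h := locallyIntegrableOn_mul_sum_Icc (𝕜 := ℂ) (fun k => χ k) (m := 1) (le_refl (0 : ℝ))
      (g := fun _ => (1 : ℂ)) ((locallyIntegrable_const 1).locallyIntegrableOn _)
    simp only [one_mul] at h
    exact h.mono_set Set.Ioi_subset_Ici_self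
  have hdiff {z : ℂ} (hz : 0 < z.re) : DifferentiableAt ℂ (fun z => z * mellin f (-z)) z := by
    have h : DifferentiableAt ℂ (mellin f) (-z) := by
      refine mellin_differentiableAt_of_isBigO_rpow (a := 0) (b := -z.re - 1) hloc ?_
        (by simpa using hz) ?_ (by simp)
      · refine Asymptotics.IsBigO.of_bound q (Eventually.of_forall fun t => ?_)
        simpa using norm_sum_Icc_dirichletCharacter_le hχ ⌊t⌋₊
      · refine Asymptotics.IsBigO.of_bound 1 ?_
        filter_upwards [(eventually_lt_nhds (zero_lt_one' ℝ)).filter_mono nhdsWithin_le_nhds]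
          with t ht
        rw [hf0 ht, norm_zero]
        positivity
    exact differentiableAt_id.mul (h.comp z differentiableAt_id.neg)
  have hopen : IsOpen {z : ℂ | 0 < z.re} := isOpen_lt continuous_const Complex.continuous_re
  have h1 : AnalyticOnNhd ℂ (DirichletCharacter.LFunction χ) {z : ℂ | 0 < z.re} :=
    (DirichletCharacter.differentiable_LFunction hχ).differentiableOn.analyticOnNhd hopen
  have h2 : AnalyticOnNhd ℂ (fun z => z * mellin f (-z)) {z : ℂ | 0 < z.re} :=
    DifferentiableOn.analyticOnNhd (fun z hz => (hdiff hz).differentiableWithinAt) hopen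
  have hconn : IsPreconnected {z : ℂ | 0 < z.re} := (convex_halfSpace_re_gt 0).isPreconnected
  refine h1.eqOn_of_preconnected_of_eventuallyEq h2 hconn (z₀ := 2) (by simp) ?_ hs
  have hev : ∀ᶠ z : ℂ in 𝓝 2, 1 < z.re :=
    Complex.continuous_re.continuousAt.eventually (lt_mem_nhds (by simp))
  filter_upwards [hev] with z hz
  rw [DirichletCharacter.LFunction_eq_LSeries χ hz, LSeries_eq_mul_integral _ le_rfl
    (by linarith) (DirichletCharacter.LSeriesSummable_of_one_lt_re χ hz)]
  · congr 1
    rw [mellin, setIntegral_eq_of_subset_of_forall_sdiff_eq_zero (s := Set.Ici 1)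
      measurableSet_Ioi (fun t ht => lt_of_lt_of_le zero_lt_one ht), integral_Ici_eq_integral_Ioi]
    · refine integral_congr_ae (Eventually.of_forall fun t => ?_)
      simp only [smul_eq_mul, hf]
      rw [mul_comm]
      congr 2
      ring
    · intro t ht
      rw [hf0 (not_le.mp ht.2), smul_zero]
  · refine Asymptotics.IsBigO.of_bound q (Eventually.of_forall fun n => ?_)
    simpa using norm_sum_Icc_dirichletCharacter_le hχ n

theorem norm_dirichletCharacter_LFunction_le {q : ℕ} [NeZero q]
    {χ : DirichletCharacter ℂ q} (hχ : χ ≠ 1) {κ : ℝ} (hκ : 0 < κ) (hκ' : κ ≤ 1 / 2) {s : ℂ}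
    (hs : 1 - κ ≤ s.re) :
    ‖DirichletCharacter.LFunction χ s‖ ≤ ‖s‖ * ((q : ℝ) ^ (2 * κ) / κ) := by
  rw [dirichletCharacter_LFunction_eq_mul_mellin hχ (by linarith), norm_mul]
  refine mul_le_mul_of_nonneg_left ?_ (norm_nonneg _)
  rw [mellin, setIntegral_eq_of_subset_of_forall_sdiff_eq_zero (s := Set.Ici 1)
    measurableSet_Ioi (fun t ht => lt_of_lt_of_le zero_lt_one ht), integral_Ici_eq_integral_Ioi]
  · have hdom : IntegrableOn (fun t : ℝ => (q : ℝ) ^ (2 * κ) * t ^ (-κ - 1)) (Set.Ioi 1) :=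
      (integrableOn_Ioi_rpow_of_lt (by linarith) one_pos).const_mul _
    have hval : ∫ t in Set.Ioi (1 : ℝ), (q : ℝ) ^ (2 * κ) * t ^ (-κ - 1) =
        (q : ℝ) ^ (2 * κ) / κ := by
      rw [integral_const_mul, integral_Ioi_rpow_of_lt (by linarith) one_pos]
      simp
      field_simp
    rw [← hval]
    refine norm_integral_le_of_norm_le hdom ?_
    filter_upwards [ae_restrict_mem measurableSet_Ioi] with t ht
    have ht1 : (1 : ℝ) < t := ht
    have ht0 : (0 : ℝ) < t := by linarith
    rw [norm_smul, Complex.norm_cpow_eq_rpow_re_of_pos ht0]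
    have h1 : t ^ ((-s - 1).re) ≤ t ^ (κ - 2) := by
      refine Real.rpow_le_rpow_of_exponent_le ht1.le ?_
      simp only [Complex.sub_re, Complex.neg_re, Complex.one_re]
      linarith
    calc _ ≤ t ^ (κ - 2) * ((q : ℝ) ^ (2 * κ) * t ^ (1 - 2 * κ)) :=
          mul_le_mul h1 (norm_sum_Icc_dirichletCharacter_le_rpow hχ (by linarith) (by linarith) ht0)
            (norm_nonneg _) (by positivity)
      _ = (q : ℝ) ^ (2 * κ) * (t ^ (κ - 2) * t ^ (1 - 2 * κ)) := by ring
      _ = _ := by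
          rw [← Real.rpow_add ht0]
          congr 2
          ring
  · intro t ht
    have : ⌊t⌋₊ = 0 := Nat.floor_eq_zero.mpr (not_le.mp ht.2)
    simp [this]

end LFunctionBounds

section ExceptionalPrimes

open Finset
open scoped Topology

theorem eventually_const_mul_rpow_le (c : ℝ) {a b : ℝ} (hab : a < b) :
    ∀ᶠ y : ℝ in atTop, c * y ^ a ≤ y ^ b := by
  filter_upwards [(tendsto_rpow_atTop (sub_pos.mpr hab)).eventually_ge_atTop c,
    eventually_gt_atTop 0] with y hy hy0
  calc c * y ^ a ≤ y ^ (b - a) * y ^ a := by gcongr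
    _ = y ^ b := by rw [← Real.rpow_add hy0, sub_add_cancel]

theorem exists_eventually_norm_LFunction_le {δ : ℝ} (hδ : 0 < δ) :
    ∃ κ : ℝ, 0 < κ ∧ ∀ᶠ y : ℝ in atTop, ∀ (q : ℕ) [NeZero q], (q : ℝ) ≤ y ^ 2 →
      ∀ χ : DirichletCharacter ℂ q, χ ≠ 1 → ∀ s : ℂ, ‖s - 1‖ ≤ κ →
        ‖DirichletCharacter.LFunction χ s‖ ≤ y ^ δ ∧
        ‖deriv (DirichletCharacter.LFunction χ) s‖ ≤ y ^ δ := by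
  set κ := min (1 / 2) (δ / 8) with hκdef
  have hκ : 0 < κ := by positivity
  have hκ2 : κ ≤ 1 / 2 := min_le_left _ _
  have hκδ : κ ≤ δ / 8 := min_le_right _ _
  refine ⟨κ / 2, by positivity, ?_⟩
  filter_upwards [eventually_const_mul_rpow_le (2 / κ) (half_lt_self hδ),
    eventually_const_mul_rpow_le (2 / κ / (κ / 2)) (half_lt_self hδ), eventually_ge_atTop 1]
    with y hy1 hy2 hy q hq hqy χ hχ s hs
  have hbound {z : ℂ} (hz : ‖z - 1‖ ≤ κ) :
      ‖DirichletCharacter.LFunction χ z‖ ≤ 2 / κ * y ^ (δ / 2) := by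
    have hre : 1 - κ ≤ z.re := by
      have := (Complex.abs_re_le_norm (z - 1)).trans hz
      rw [Complex.sub_re, Complex.one_re, abs_le] at this
      linarith [this.1]
    have hn : ‖z‖ ≤ 2 := by
      have := norm_le_norm_sub_add z 1
      rw [norm_one] at this
      linarith
    refine (norm_dirichletCharacter_LFunction_le hχ hκ hκ2 hre).trans ?_
    have h1 : (q : ℝ) ^ (2 * κ) ≤ y ^ (δ / 2) := by
      calc (q : ℝ) ^ (2 * κ) ≤ (y ^ 2) ^ (2 * κ) :=
            Real.rpow_le_rpow (by positivity) hqy (by positivity)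
        _ = y ^ (4 * κ) := by
            rw [← Real.rpow_natCast, ← Real.rpow_mul (by linarith)]
            congr 1
            push_cast
            ring
        _ ≤ y ^ (δ / 2) := Real.rpow_le_rpow_of_exponent_le hy (by linarith)
    calc ‖z‖ * ((q : ℝ) ^ (2 * κ) / κ) ≤ 2 * (y ^ (δ / 2) / κ) := by gcongr
      _ = _ := by ring
  refine ⟨(hbound (by linarith)).trans hy1, ?_⟩
  have hd := Complex.norm_deriv_le_of_forall_mem_sphere_norm_le (c := s) (R := κ / 2)
    (C := 2 / κ * y ^ (δ / 2)) (f := DirichletCharacter.LFunction χ) (by positivity)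
    (DirichletCharacter.differentiable_LFunction hχ).diffContOnCl fun z hz => hbound ?_
  · refine hd.trans ?_
    calc 2 / κ * y ^ (δ / 2) / (κ / 2) = 2 / κ / (κ / 2) * y ^ (δ / 2) := by ring
      _ ≤ _ := hy2
  · rw [mem_sphere_iff_norm] at hz
    have := norm_sub_le_norm_sub_add_norm_sub z s 1
    linarith

theorem norm_LFunction_one_add_sub_le {q : ℕ} [NeZero q] {χ : DirichletCharacter ℂ q}
    (hχ : χ ≠ 1) {κ M : ℝ} (hM : ∀ s : ℂ, ‖s - 1‖ ≤ κ →
      ‖deriv (DirichletCharacter.LFunction χ) s‖ ≤ M) {s : ℂ} (hs : ‖s - 1‖ ≤ κ) :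
    ‖DirichletCharacter.LFunction χ s - DirichletCharacter.LFunction χ 1‖ ≤ M * ‖s - 1‖ := by
  refine Convex.norm_image_sub_le_of_norm_deriv_le (s := Metric.closedBall 1 κ) (𝕜 := ℂ)
    (fun x _ => (DirichletCharacter.differentiable_LFunction hχ) x) (fun x hx => hM x ?_)
    (convex_closedBall 1 κ) ?_ ?_
  · rwa [mem_closedBall_iff_norm] at hx
  · exact Metric.mem_closedBall_self ((norm_nonneg _).trans hs)
  · rwa [mem_closedBall_iff_norm]

theorem eventually_norm_riemannZeta_one_add_le :
    ∀ᶠ η : ℝ in 𝓝[>] 0, ‖riemannZeta (1 + η)‖ ≤ 2 / η := by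
  have h1 : Tendsto (fun η : ℝ => (1 : ℂ) + η) (𝓝[>] 0) (𝓝[≠] 1) := by
    refine tendsto_nhdsWithin_iff.mpr ⟨?_, ?_⟩
    · have : Continuous fun η : ℝ => (1 : ℂ) + η := by fun_prop
      have h := this.tendsto 0
      simp only [Complex.ofReal_zero, add_zero] at h
      exact h.mono_left nhdsWithin_le_nhds
    · filter_upwards [self_mem_nhdsWithin] with η hη
      simpa using (ne_of_gt hη)
  have h2 := (riemannZeta_residue_one.comp h1).norm.eventually
    (gt_mem_nhds (show ‖(1 : ℂ)‖ < 2 by simp))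
  filter_upwards [h2, self_mem_nhdsWithin] with η h hη
  have hη : (0 : ℝ) < η := hη
  rw [le_div_iff₀ hη, mul_comm]
  simp only [Function.comp_apply, add_sub_cancel_left, norm_mul, Complex.norm_real,
    Real.norm_eq_abs, abs_of_pos hη] at h
  exact h.le

theorem norm_LFunctionTrivChar_prime_le {q : ℕ} (hq : q.Prime) [NeZero q] {s : ℂ}
    (hs : 1 < s.re) : ‖DirichletCharacter.LFunctionTrivChar q s‖ ≤ 2 * ‖riemannZeta s‖ := by
  rw [DirichletCharacter.LFunctionTrivChar_eq_mul_riemannZeta (by rintro rfl; simp at hs),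
    hq.primeFactors, Finset.prod_singleton, norm_mul]
  refine mul_le_mul_of_nonneg_right ?_ (norm_nonneg _)
  have h1 : ‖(q : ℂ) ^ (-s)‖ ≤ 1 := by
    rw [Complex.norm_natCast_cpow_of_pos hq.pos]
    exact Real.rpow_le_one_of_one_le_of_nonpos (by exact_mod_cast hq.one_le)
      (by simp only [Complex.neg_re]; linarith)
  calc _ ≤ ‖(1 : ℂ)‖ + ‖(q : ℂ) ^ (-s)‖ := norm_sub_le _ _
    _ ≤ 2 := by rw [norm_one]; linarith

theorem dirichletCharacter_apply_eq_of_sq_eq_one {q : ℕ} {χ : DirichletCharacter ℂ q}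
    (hχ : χ ^ 2 = 1) (a : ZMod q) : χ a = 0 ∨ χ a = 1 ∨ χ a = -1 := by
  by_cases ha : IsUnit a
  · right
    have h : (χ a) ^ 2 = 1 := by
      rw [← MulChar.pow_apply' χ two_ne_zero, hχ, MulChar.one_apply ha]
    rw [sq] at h
    exact mul_self_eq_one_iff.mp h
  · exact Or.inl (χ.map_nonunit ha)

/-- The product of two Dirichlet characters, as a character modulo the product of the moduli. -/
noncomputable def dirichletCharacterProd {q₁ q₂ : ℕ} (χ₁ : DirichletCharacter ℂ q₁)
    (χ₂ : DirichletCharacter ℂ q₂) : DirichletCharacter ℂ (q₁ * q₂) :=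
  DirichletCharacter.changeLevel (dvd_mul_right q₁ q₂) χ₁ *
    DirichletCharacter.changeLevel (dvd_mul_left q₂ q₁) χ₂

theorem dirichletCharacterProd_natCast {q₁ q₂ : ℕ} (χ₁ : DirichletCharacter ℂ q₁)
    (χ₂ : DirichletCharacter ℂ q₂) (n : ℕ) :
    dirichletCharacterProd χ₁ χ₂ n = χ₁ n * χ₂ n := by
  by_cases h : IsUnit (n : ZMod (q₁ * q₂))
  · obtain ⟨u, hu⟩ := h
    rw [dirichletCharacterProd, MulChar.mul_apply, ← hu,
      DirichletCharacter.changeLevel_eq_cast_of_dvd,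
      DirichletCharacter.changeLevel_eq_cast_of_dvd, hu,
      ZMod.cast_natCast (dvd_mul_right q₁ q₂), ZMod.cast_natCast (dvd_mul_left q₂ q₁)]
  · rw [MulChar.map_nonunit _ h]
    rw [ZMod.isUnit_iff_coprime, Nat.coprime_mul_iff_right, not_and_or,
      ← ZMod.isUnit_iff_coprime, ← ZMod.isUnit_iff_coprime] at h
    rcases h with h | h
    · rw [MulChar.map_nonunit _ h, zero_mul]
    · rw [MulChar.map_nonunit _ h, mul_zero]

theorem dirichletCharacterProd_ne_one {q₁ q₂ : ℕ} (hq : q₁.Coprime q₂)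
    {χ₁ : DirichletCharacter ℂ q₁} (hχ₁ : χ₁ ≠ 1) (χ₂ : DirichletCharacter ℂ q₂) [NeZero q₁] :
    dirichletCharacterProd χ₁ χ₂ ≠ 1 := by
  intro h
  refine hχ₁ (MulChar.ext fun u => ?_)
  obtain ⟨n, hn1, hn2⟩ := Nat.chineseRemainder hq (u : ZMod q₁).val 1
  have e1 : (n : ZMod q₁) = u := by
    rw [(ZMod.natCast_eq_natCast_iff _ _ _).mpr hn1, ZMod.natCast_zmod_val]
  have e2 : (n : ZMod q₂) = 1 := by
    rw [(ZMod.natCast_eq_natCast_iff _ _ _).mpr hn2, Nat.cast_one]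
  have hu1 : IsUnit (n : ZMod q₁) := e1 ▸ u.isUnit
  have hu2 : IsUnit (n : ZMod q₂) := e2 ▸ isUnit_one
  have hu : IsUnit (n : ZMod (q₁ * q₂)) := by
    rw [ZMod.isUnit_iff_coprime] at hu1 hu2 ⊢
    exact Nat.Coprime.mul_right hu1 hu2
  have h3 := dirichletCharacterProd_natCast χ₁ χ₂ n
  rw [h, MulChar.one_apply hu, e2, map_one, mul_one, e1] at h3
  rw [← h3, MulChar.one_apply u.isUnit]

theorem biquadratic_euler_factor_bounds {a b u : ℝ} (ha : a = 0 ∨ a = 1 ∨ a = -1)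
    (hb : b = 0 ∨ b = 1 ∨ b = -1) (hu0 : 0 < u) (hu1 : u < 1) :
    0 < (1 - u) * (1 - a * u) * (1 - b * u) * (1 - a * b * u) ∧
    (1 - u) * (1 - a * u) * (1 - b * u) * (1 - a * b * u) ≤ 1 := by
  have hpos {c : ℝ} (hc : c = 0 ∨ c = 1 ∨ c = -1) : 0 < 1 - c * u := by
    rcases hc with rfl | rfl | rfl <;> linarith
  have hab : a * b = 0 ∨ a * b = 1 ∨ a * b = -1 := by
    rcases ha with rfl | rfl | rfl <;> rcases hb with rfl | rfl | rfl <;> norm_num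
  have h1 : 0 < 1 - u := by linarith
  refine ⟨mul_pos (mul_pos (mul_pos h1 (hpos ha)) (hpos hb)) (hpos hab), ?_⟩
  have h3 : (1 - u) * (1 + u) ≤ 1 := by nlinarith
  have h4 : 0 < (1 - u) * (1 + u) := mul_pos h1 (by linarith)
  have h5 : ((1 - u) * (1 + u)) * ((1 - u) * (1 + u)) ≤ 1 := mul_le_one₀ h3 h4.le h3
  have h6 : (1 - u) ^ 2 ≤ 1 := pow_le_one₀ h1.le (by linarith)
  have h7 : (1 - u) ^ 4 ≤ 1 := pow_le_one₀ h1.le (by linarith)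
  rcases ha with rfl | rfl | rfl <;> rcases hb with rfl | rfl | rfl <;> norm_num <;> nlinarith

theorem one_le_norm_riemannZeta_mul_LFunction_mul {q₁ q₂ : ℕ} [NeZero q₁] [NeZero q₂]
    {χ₁ : DirichletCharacter ℂ q₁} {χ₂ : DirichletCharacter ℂ q₂} (h₁ : χ₁ ^ 2 = 1)
    (h₂ : χ₂ ^ 2 = 1) {σ : ℝ} (hσ : 1 < σ) :
    1 ≤ ‖riemannZeta σ‖ * ‖DirichletCharacter.LFunction χ₁ σ‖ *
      ‖DirichletCharacter.LFunction χ₂ σ‖ *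
      ‖DirichletCharacter.LFunction (dirichletCharacterProd χ₁ χ₂) σ‖ := by
  have hσ' : 1 < (σ : ℂ).re := by simpa using hσ
  rw [DirichletCharacter.LFunction_eq_LSeries _ hσ', DirichletCharacter.LFunction_eq_LSeries _ hσ',
    DirichletCharacter.LFunction_eq_LSeries _ hσ']
  refine ge_of_tendsto' ((((riemannZeta_eulerProduct hσ').norm.mul
    (DirichletCharacter.LSeries_eulerProduct χ₁ hσ').norm).mul
    (DirichletCharacter.LSeries_eulerProduct χ₂ hσ').norm).mul
    (DirichletCharacter.LSeries_eulerProduct (dirichletCharacterProd χ₁ χ₂) hσ').norm) fun n => ?_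
  simp only [norm_prod, ← Finset.prod_mul_distrib]
  refine Finset.prod_induction _ (fun t : ℝ => 1 ≤ t)
    (fun a b => one_le_mul_of_one_le_of_one_le) le_rfl fun p hp => ?_
  have hpp : p.Prime := Nat.prime_of_mem_primesBelow hp
  have hu0 : 0 < (p : ℝ) ^ (-σ) := Real.rpow_pos_of_pos (by exact_mod_cast hpp.pos) _
  have hu1 : (p : ℝ) ^ (-σ) < 1 :=
    Real.rpow_lt_one_of_one_lt_of_neg (by exact_mod_cast hpp.one_lt) (by linarith)
  have hpow : (p : ℂ) ^ (-(σ : ℂ)) = (((p : ℝ) ^ (-σ) : ℝ) : ℂ) := by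
    rw [Complex.ofReal_cpow (by positivity)]
    simp
  have hreal {q : ℕ} {χ : DirichletCharacter ℂ q} (h : χ ^ 2 = 1) :
      ∃ a : ℝ, χ p = a ∧ (a = 0 ∨ a = 1 ∨ a = -1) := by
    rcases dirichletCharacter_apply_eq_of_sq_eq_one h p with h | h | h
    · exact ⟨0, by simp [h], by simp⟩
    · exact ⟨1, by simp [h], by simp⟩
    · exact ⟨-1, by simp [h], by simp⟩
  obtain ⟨a, ha, ha'⟩ := hreal h₁
  obtain ⟨b, hb, hb'⟩ := hreal h₂
  rw [dirichletCharacterProd_natCast, ha, hb, hpow, ← norm_mul, ← norm_mul, ← norm_mul,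
    ← mul_inv, ← mul_inv, ← mul_inv, norm_inv]
  obtain ⟨h3, h4⟩ := biquadratic_euler_factor_bounds ha' hb' hu0 hu1
  have h5 : ‖(1 - (((p : ℝ) ^ (-σ) : ℝ) : ℂ)) * (1 - a * ((p : ℝ) ^ (-σ) : ℝ)) *
      (1 - b * ((p : ℝ) ^ (-σ) : ℝ)) * (1 - a * b * ((p : ℝ) ^ (-σ) : ℝ))‖ =
      (1 - (p : ℝ) ^ (-σ)) * (1 - a * (p : ℝ) ^ (-σ)) * (1 - b * (p : ℝ) ^ (-σ)) *
        (1 - a * b * (p : ℝ) ^ (-σ)) := by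
    rw [← Real.norm_of_nonneg h3.le, ← Complex.norm_real]
    push_cast
    rfl
  rw [h5]
  exact (one_le_inv₀ h3).mpr h4

end ExceptionalPrimes

section ExceptionalUniqueness

open Finset
open scoped Topology

/-- For large `y`, at most one prime `q ≤ y` is the modulus of a nontrivial character whose
`L`-function is smaller than `y ^ (-δ)` at `1`. -/
theorem eventually_exceptional_prime_unique {δ : ℝ} (hδ : 0 < δ) :
    ∀ᶠ y : ℝ in atTop, ∀ (q₁ q₂ : ℕ) [NeZero q₁] [NeZero q₂], q₁.Prime → q₂.Prime →
      (q₁ : ℝ) ≤ y → (q₂ : ℝ) ≤ y →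
      ∀ (χ₁ : DirichletCharacter ℂ q₁) (χ₂ : DirichletCharacter ℂ q₂), χ₁ ≠ 1 → χ₂ ≠ 1 →
        ‖DirichletCharacter.LFunction χ₁ 1‖ < y ^ (-δ) →
        ‖DirichletCharacter.LFunction χ₂ 1‖ < y ^ (-δ) → q₁ = q₂ := by
  obtain ⟨κ, hκ, hL⟩ := exists_eventually_norm_LFunction_le (δ := δ / 10) (by positivity)
  have hη0 : Tendsto (fun y : ℝ => y ^ (-δ)) atTop (𝓝 0) := tendsto_rpow_neg_atTop hδ
  have hη : Tendsto (fun y : ℝ => y ^ (-δ)) atTop (𝓝[>] 0) := by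
    refine tendsto_nhdsWithin_iff.mpr ⟨hη0, ?_⟩
    filter_upwards [eventually_gt_atTop 0] with y hy using Real.rpow_pos_of_pos hy _
  filter_upwards [hL, hη.eventually eventually_norm_riemannZeta_one_add_le,
    hη0.eventually (gt_mem_nhds hκ), eventually_ge_atTop 1,
    (tendsto_rpow_atTop (show 0 < δ / 10 by positivity)).eventually_ge_atTop 1025]
    with y hL hζ hyκ hy1 hA q₁ q₂ hz₁ hz₂ hq₁ hq₂ hqy₁ hqy₂ χ₁ χ₂ hχ₁ hχ₂ he₁ he₂
  set A := y ^ (δ / 10) with hAdef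
  have hA0 : 0 < A := by linarith
  have hη_eq : y ^ (-δ) = (A ^ 10)⁻¹ := by
    rw [hAdef, ← Real.rpow_natCast, ← Real.rpow_mul (by linarith), ← Real.rpow_neg (by linarith)]
    congr 1
    push_cast
    ring
  rw [hη_eq] at hζ hyκ he₁ he₂
  set η := (A ^ 10)⁻¹ with hηdef
  have hηpos : 0 < η := by positivity
  have hζ' : ‖riemannZeta (1 + η)‖ ≤ 2 * A ^ 10 := by
    rwa [hηdef, div_inv_eq_mul, ← hηdef] at hζ
  have hs : ‖(1 + η : ℂ) - 1‖ = η := by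
    rw [add_sub_cancel_left, Complex.norm_real, Real.norm_of_nonneg hηpos.le]
  have hsq {q : ℕ} (hq : (q : ℝ) ≤ y) : (q : ℝ) ≤ y ^ 2 := by nlinarith
  have hsmall {q : ℕ} [NeZero q] (hqy : (q : ℝ) ≤ y) {χ : DirichletCharacter ℂ q}
      (hχ : χ ≠ 1) (he : ‖DirichletCharacter.LFunction χ 1‖ < η) :
      ‖DirichletCharacter.LFunction χ (1 + η)‖ ≤ 2 * A * η := by
    have h1 := norm_LFunction_one_add_sub_le hχ (fun s hs => (hL q (hsq hqy) χ hχ s hs).2)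
      (s := 1 + η) (by rw [hs]; exact hyκ.le)
    rw [hs] at h1
    have h2 := norm_le_norm_sub_add (DirichletCharacter.LFunction χ (1 + η))
      (DirichletCharacter.LFunction χ 1)
    nlinarith
  have hquad {q : ℕ} [NeZero q] (hq : q.Prime) (hqy : (q : ℝ) ≤ y) {χ : DirichletCharacter ℂ q}
      (hχ : χ ≠ 1) (he : ‖DirichletCharacter.LFunction χ 1‖ < η) : χ ^ 2 = 1 := by
    by_contra hχ2
    have h1 := DirichletCharacter.norm_LFunction_product_ge_one χ hηpos 0
    simp only [Complex.ofReal_zero, mul_zero, add_zero, norm_mul, norm_pow] at h1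
    have h2 := (norm_LFunctionTrivChar_prime_le hq (s := 1 + η) (by simpa using hηpos)).trans
      (mul_le_mul_of_nonneg_left hζ' zero_le_two)
    have h3 := hsmall hqy hχ he
    have h4 := (hL q (hsq hqy) (χ ^ 2) hχ2 (1 + η) (by rw [hs]; exact hyκ.le)).1
    have h5 : (1 : ℝ) ≤ (2 * (2 * A ^ 10)) ^ 3 * (2 * A * η) ^ 4 * A := by
      refine le_trans h1 ?_
      gcongr
    have h6 : (2 * (2 * A ^ 10)) ^ 3 * (2 * A * η) ^ 4 * A = 1024 / A ^ 5 := by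
      rw [hηdef]
      field_simp
      norm_num
    rw [h6, le_div_iff₀ (by positivity)] at h5
    have h7 : A ≤ A ^ 5 := le_self_pow₀ (by linarith) (by norm_num)
    linarith
  by_contra hne
  have h1 := one_le_norm_riemannZeta_mul_LFunction_mul (hquad hq₁ hqy₁ hχ₁ he₁)
    (hquad hq₂ hqy₂ hχ₂ he₂) (σ := 1 + η) (by linarith)
  push_cast at h1
  have h2 := hsmall hqy₁ hχ₁ he₁
  have h3 := hsmall hqy₂ hχ₂ he₂
  have hprod : ((q₁ * q₂ : ℕ) : ℝ) ≤ y ^ 2 := by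
    push_cast
    rw [sq]
    gcongr
  have h4 := (hL (q₁ * q₂) hprod (dirichletCharacterProd χ₁ χ₂)
    (dirichletCharacterProd_ne_one ((Nat.coprime_primes hq₁ hq₂).mpr hne) hχ₁ χ₂) (1 + η)
    (by rw [hs]; exact hyκ.le)).1
  have h5 : (1 : ℝ) ≤ 2 * A ^ 10 * (2 * A * η) * (2 * A * η) * A := by
    refine le_trans h1 ?_
    gcongr
  have h6 : 2 * A ^ 10 * (2 * A * η) * (2 * A * η) * A = 8 / A ^ 7 := by
    rw [hηdef]
    field_simp
    norm_num
  rw [h6, le_div_iff₀ (by positivity)] at h5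
  have h7 : A ≤ A ^ 7 := le_self_pow₀ (by linarith) (by norm_num)
  linarith

/-- The nontrivial `L`-functions to a bounded prime modulus are at least `y ^ (-δ)` at `1` once
`y` is large. -/
theorem eventually_rpow_neg_le_norm_LFunction_one {δ : ℝ} (hδ : 0 < δ) (Q : ℕ) :
    ∀ᶠ y : ℝ in atTop, ∀ (q : ℕ) [NeZero q], q ≤ Q → ∀ χ : DirichletCharacter ℂ q, χ ≠ 1 →
      y ^ (-δ) ≤ ‖DirichletCharacter.LFunction χ 1‖ := by
  have h : ∀ q ∈ Finset.Iic Q, ∀ᶠ y : ℝ in atTop, ∀ [NeZero q], ∀ χ : DirichletCharacter ℂ q,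
      χ ≠ 1 → y ^ (-δ) ≤ ‖DirichletCharacter.LFunction χ 1‖ := by
    intro q _
    rcases eq_or_ne q 0 with rfl | hq
    · exact Eventually.of_forall fun y h => absurd rfl h.out
    · have := NeZero.mk hq
      have h : ∀ᶠ y : ℝ in atTop, ∀ χ : DirichletCharacter ℂ q,
          χ ≠ 1 → y ^ (-δ) ≤ ‖DirichletCharacter.LFunction χ 1‖ := by
        refine eventually_all.mpr fun χ => ?_
        by_cases hχ : χ = 1
        · exact Eventually.of_forall fun y h => absurd hχ h
        · have hpos : 0 < ‖DirichletCharacter.LFunction χ 1‖ :=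
            norm_pos_iff.mpr (DirichletCharacter.LFunction_apply_one_ne_zero hχ)
          filter_upwards [(tendsto_rpow_neg_atTop hδ).eventually (gt_mem_nhds hpos)] with y hy _
            using hy.le
      filter_upwards [h] with y hy _ using hy
  filter_upwards [(Filter.eventually_all_finset _).mpr h] with y hy q _ hqQ
    using hy q (Finset.mem_Iic.mpr hqQ)

end ExceptionalUniqueness

section TwistedLogSums

open Finset
open scoped Topology

/-- The term `Λ(n) (log n) ^ k n ^ (-1 - η)` of the `k`-th derivative of the logarithmic
derivative of the zeta function at `1 + η`, up to sign. -/
noncomputable def vonMangoldtLogTerm (k : ℕ) (η : ℝ) (n : ℕ) : ℝ :=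
  ArithmeticFunction.vonMangoldt n * Real.log n ^ k / (n : ℝ) ^ (1 + η)

theorem vonMangoldtLogTerm_nonneg (k : ℕ) (η : ℝ) (n : ℕ) : 0 ≤ vonMangoldtLogTerm k η n :=
  div_nonneg (mul_nonneg ArithmeticFunction.vonMangoldt_nonneg
    (pow_nonneg (Real.log_natCast_nonneg n) k)) (by positivity)

theorem logMul_iterate_apply (f : ℕ → ℂ) (k n : ℕ) :
    LSeries.logMul^[k] f n = Complex.log n ^ k * f n := by
  induction k with
  | zero => simp
  | succ k ih =>
    rw [Function.iterate_succ_apply', LSeries.logMul, ih, pow_succ', mul_assoc]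

theorem LSeries_term_logMul_iterate (f : ℕ → ℂ) (k : ℕ) (η : ℝ) (n : ℕ) :
    LSeries.term (LSeries.logMul^[k] (f * fun n => (ArithmeticFunction.vonMangoldt n : ℂ)))
      (1 + η) n = f n * (vonMangoldtLogTerm k η n : ℂ) := by
  rcases eq_or_ne n 0 with rfl | hn
  · simp [vonMangoldtLogTerm]
  · rw [LSeries.term_of_ne_zero hn, logMul_iterate_apply, vonMangoldtLogTerm, Pi.mul_apply]
    push_cast
    rw [Complex.ofReal_cpow (Nat.cast_nonneg n)]
    push_cast
    ring

theorem abscissaOfAbsConv_twist_vonMangoldt_le {q : ℕ} (χ : DirichletCharacter ℂ q) :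
    LSeries.abscissaOfAbsConv ((fun n : ℕ => χ n) *
      fun n => (ArithmeticFunction.vonMangoldt n : ℂ)) ≤ (1 : ℝ) :=
  LSeries.abscissaOfAbsConv_le_of_forall_lt_LSeriesSummable fun y hy =>
    DirichletCharacter.LSeriesSummable_twist_vonMangoldt χ (by simpa using hy)

theorem LSeriesSummable_twist_vonMangoldt_logMul {q : ℕ} (χ : DirichletCharacter ℂ q) (k : ℕ)
    {s : ℂ} (hs : 1 < s.re) :
    LSeriesSummable (LSeries.logMul^[k] ((fun n : ℕ => χ n) *
      fun n => (ArithmeticFunction.vonMangoldt n : ℂ))) s := by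
  refine LSeriesSummable_of_abscissaOfAbsConv_lt_re ?_
  rw [LSeries.absicssaOfAbsConv_logPowMul]
  exact (abscissaOfAbsConv_twist_vonMangoldt_le χ).trans_lt (by exact_mod_cast hs)

theorem summable_mul_vonMangoldtLogTerm {q : ℕ} (χ : DirichletCharacter ℂ q) (k : ℕ) {η : ℝ}
    (hη : 0 < η) : Summable fun n : ℕ => χ n * (vonMangoldtLogTerm k η n : ℂ) :=
  (LSeriesSummable_twist_vonMangoldt_logMul χ k (s := 1 + η) (by simpa)).congr
    (LSeries_term_logMul_iterate (fun n : ℕ => χ n) k η)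

theorem summable_vonMangoldtLogTerm (k : ℕ) {η : ℝ} (hη : 0 < η) :
    Summable (vonMangoldtLogTerm k η) := by
  have h := summable_mul_vonMangoldtLogTerm (1 : DirichletCharacter ℂ 1) k hη
  simp only [MulChar.one_apply (isUnit_of_subsingleton _), one_mul] at h
  exact Complex.summable_ofReal.mp h

theorem norm_tsum_mul_vonMangoldtLogTerm {q : ℕ} [NeZero q] (χ : DirichletCharacter ℂ q) (k : ℕ)
    {η : ℝ} (hη : 0 < η) :
    ‖∑' n : ℕ, χ n * (vonMangoldtLogTerm k η n : ℂ)‖ =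
      ‖iteratedDeriv k (fun s => deriv (DirichletCharacter.LFunction χ) s /
        DirichletCharacter.LFunction χ s) (1 + η)‖ := by
  have hre : 1 < (1 + η : ℂ).re := by simpa
  have h1 : (fun s => deriv (DirichletCharacter.LFunction χ) s /
      DirichletCharacter.LFunction χ s) =ᶠ[𝓝 (1 + η : ℂ)]
      -LSeries ((fun n : ℕ => χ n) * fun n => (ArithmeticFunction.vonMangoldt n : ℂ)) := by
    filter_upwards [(isOpen_lt continuous_const Complex.continuous_re).mem_nhds hre] with s hs
    rw [Pi.neg_apply, DirichletCharacter.LSeries_twist_vonMangoldt_eq χ hs,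
      DirichletCharacter.deriv_LFunction_eq_deriv_LSeries χ hs,
      DirichletCharacter.LFunction_eq_LSeries χ hs, neg_div, neg_neg]
  rw [h1.iteratedDeriv_eq, iteratedDeriv_neg, LSeries_iteratedDeriv, norm_neg, norm_mul, norm_pow,
    norm_neg, norm_one, one_pow, one_mul, LSeries]
  · simp only [LSeries_term_logMul_iterate]
  · exact (abscissaOfAbsConv_twist_vonMangoldt_le χ).trans_lt (by exact_mod_cast hre)

theorem norm_iteratedDeriv_logDeriv_LFunction_le {q : ℕ} [NeZero q] {χ : DirichletCharacter ℂ q}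
    (hχ : χ ≠ 1) {B : ℝ} (hB : 2 ≤ B)
    (h1 : B⁻¹ ≤ ‖DirichletCharacter.LFunction χ 1‖)
    (hderiv : ∀ s : ℂ, ‖s - 1‖ ≤ (B ^ 3)⁻¹ → ‖deriv (DirichletCharacter.LFunction χ) s‖ ≤ B)
    (k : ℕ) :
    ‖iteratedDeriv k (fun s => deriv (DirichletCharacter.LFunction χ) s /
        DirichletCharacter.LFunction χ s) (1 + ((B ^ 4)⁻¹ : ℝ))‖ ≤
      k.factorial * (2 * B ^ 2) / ((B ^ 3)⁻¹ / 2) ^ k := by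
  have hB0 : 0 < B := by linarith
  have hlow {s : ℂ} (hs : ‖s - 1‖ ≤ (B ^ 3)⁻¹) :
      B⁻¹ / 2 ≤ ‖DirichletCharacter.LFunction χ s‖ := by
    have h2 := norm_LFunction_one_add_sub_le hχ hderiv hs
    have h3 := norm_sub_norm_le (DirichletCharacter.LFunction χ 1)
      (DirichletCharacter.LFunction χ s)
    rw [norm_sub_rev] at h3
    have h4 : B * ‖s - 1‖ ≤ B⁻¹ / 2 := by
      calc B * ‖s - 1‖ ≤ B * (B ^ 3)⁻¹ := by gcongr
        _ = B⁻¹ * B⁻¹ := by field_simp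
        _ ≤ B⁻¹ * 2⁻¹ := by gcongr
        _ = B⁻¹ / 2 := by ring
    linarith
  have hball {s : ℂ} (hs : s ∈ Metric.closedBall (1 + ((B ^ 4)⁻¹ : ℝ) : ℂ) ((B ^ 3)⁻¹ / 2)) :
      ‖s - 1‖ ≤ (B ^ 3)⁻¹ := by
    rw [mem_closedBall_iff_norm] at hs
    have h2 : ‖s - 1‖ ≤ ‖s - (1 + ((B ^ 4)⁻¹ : ℝ))‖ + ‖(((B ^ 4)⁻¹ : ℝ) : ℂ)‖ := by
      refine le_trans (le_of_eq ?_) (norm_add_le _ _)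
      congr 1
      ring
    rw [Complex.norm_real, Real.norm_of_nonneg (by positivity)] at h2
    have h3 : (B ^ 4)⁻¹ ≤ (B ^ 3)⁻¹ / 2 := by
      calc (B ^ 4)⁻¹ = (B ^ 3)⁻¹ * B⁻¹ := by field_simp
        _ ≤ (B ^ 3)⁻¹ * 2⁻¹ := by gcongr
        _ = (B ^ 3)⁻¹ / 2 := by ring
    linarith
  have hdiff := DirichletCharacter.differentiable_LFunction hχ
  refine Complex.norm_iteratedDeriv_le_of_forall_mem_sphere_norm_le k (by positivity) ?_ ?_
  · refine DifferentiableOn.diffContOnCl fun s hs => ?_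
    have hs' := hball (Metric.closure_ball_subset_closedBall hs)
    have hne : DirichletCharacter.LFunction χ s ≠ 0 := by
      rw [← norm_pos_iff]
      exact lt_of_lt_of_le (by positivity) (hlow hs')
    have hd : DifferentiableAt ℂ (deriv (DirichletCharacter.LFunction χ)) s :=
      (hdiff.contDiff (n := 2)).differentiable_deriv_two s
    exact (hd.div (hdiff s) hne).differentiableWithinAt
  · intro s hs
    have hs' := hball (Metric.sphere_subset_closedBall hs)
    rw [norm_div, div_le_iff₀ (lt_of_lt_of_le (by positivity) (hlow hs'))]
    calc _ ≤ B := hderiv s hs'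
      _ = 2 * B ^ 2 * (B⁻¹ / 2) := by field_simp
      _ ≤ _ := by gcongr; exact hlow hs'

theorem norm_tsum_mul_vonMangoldtLogTerm_le {q : ℕ} [NeZero q] {χ : DirichletCharacter ℂ q}
    (hχ : χ ≠ 1) {B : ℝ} (hB : 2 ≤ B)
    (h1 : B⁻¹ ≤ ‖DirichletCharacter.LFunction χ 1‖)
    (hderiv : ∀ s : ℂ, ‖s - 1‖ ≤ (B ^ 3)⁻¹ → ‖deriv (DirichletCharacter.LFunction χ) s‖ ≤ B)
    (k : ℕ) :
    ‖∑' n : ℕ, χ n * (vonMangoldtLogTerm k (B ^ 4)⁻¹ n : ℂ)‖ ≤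
      2 ^ (k + 1) * k.factorial * B ^ (3 * k + 2) := by
  rw [norm_tsum_mul_vonMangoldtLogTerm χ k (by positivity)]
  refine (norm_iteratedDeriv_logDeriv_LFunction_le hχ hB h1 hderiv k).trans (le_of_eq ?_)
  have hB0 : 0 < B := by linarith
  rw [div_pow, inv_pow, ← pow_mul]
  field_simp
  ring

/-- Orthogonality of characters, isolating a residue class. -/
theorem tsum_coprime_sub_le_totient_mul_tsum_residueClass {q : ℕ} [NeZero q] {a : ZMod q}
    (ha : IsUnit a) {g : ℕ → ℝ} (hg0 : ∀ n, 0 ≤ g n) (hg : Summable g) {M : ℝ} (hM0 : 0 ≤ M)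
    (hM : ∀ χ : DirichletCharacter ℂ q, χ ≠ 1 → ‖∑' n : ℕ, χ n * (g n : ℂ)‖ ≤ M) :
    (∑' n : ℕ, if IsUnit (n : ZMod q) then g n else 0) - q.totient * M ≤
      q.totient * ∑' n : ℕ, if (n : ZMod q) = a then g n else 0 := by
  classical
  have hgc : Summable fun n => (g n : ℂ) := Complex.summable_ofReal.mpr hg
  have hsum (χ : DirichletCharacter ℂ q) : Summable fun n : ℕ => χ n * (g n : ℂ) := by
    refine Summable.of_norm_bounded hg fun n => ?_
    rw [norm_mul, Complex.norm_real, Real.norm_of_nonneg (hg0 n)]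
    exact mul_le_of_le_one_left (hg0 n) (χ.norm_le_one _)
  have horth : (q.totient : ℂ) * ∑' n : ℕ, ((if (n : ZMod q) = a then g n else 0 : ℝ) : ℂ) =
      ∑ χ : DirichletCharacter ℂ q, χ a⁻¹ * ∑' n : ℕ, χ n * (g n : ℂ) := by
    simp_rw [← tsum_mul_left]
    rw [← Summable.tsum_finsetSum fun χ _ => (hsum χ).mul_left _]
    refine tsum_congr fun n => ?_
    simp_rw [← mul_assoc]
    rw [← Finset.sum_mul, DirichletCharacter.sum_char_inv_mul_char_eq ℂ ha]
    by_cases h : (n : ZMod q) = a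
    · simp [h]
    · simp [h, Ne.symm h]
  have hone : (1 : DirichletCharacter ℂ q) a⁻¹ * ∑' n : ℕ, (1 : DirichletCharacter ℂ q) n *
      (g n : ℂ) = ((∑' n : ℕ, if IsUnit (n : ZMod q) then g n else 0 : ℝ) : ℂ) := by
    rw [MulChar.one_apply (IsUnit.of_mul_eq_one a (ZMod.inv_mul_of_unit a ha)), one_mul,
      Complex.ofReal_tsum]
    refine tsum_congr fun n => ?_
    by_cases h : IsUnit (n : ZMod q)
    · simp [h, MulChar.one_apply h]
    · simp [h, MulChar.map_nonunit _ h]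
  rw [← Finset.add_sum_erase _ _ (mem_univ 1), hone, ← Complex.ofReal_tsum] at horth
  have hre := congrArg Complex.re horth
  rw [← Complex.ofReal_natCast, ← Complex.ofReal_mul, Complex.ofReal_re, Complex.add_re,
    Complex.ofReal_re] at hre
  have hbound : ‖∑ χ ∈ univ.erase (1 : DirichletCharacter ℂ q),
      χ a⁻¹ * ∑' n : ℕ, χ n * (g n : ℂ)‖ ≤ q.totient * M := by
    have hterm (χ) (hχ : χ ∈ univ.erase (1 : DirichletCharacter ℂ q)) :
        ‖χ a⁻¹ * ∑' n : ℕ, χ n * (g n : ℂ)‖ ≤ M := by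
      rw [norm_mul]
      exact (mul_le_of_le_one_left (norm_nonneg _) (χ.norm_le_one _)).trans
        (hM χ (ne_of_mem_erase hχ))
    refine (norm_sum_le_of_le _ hterm).trans ?_
    rw [sum_const, nsmul_eq_mul]
    gcongr
    refine card_erase_le.trans ?_
    rw [card_univ, ← Nat.card_eq_fintype_card,
      DirichletCharacter.card_eq_totient_of_hasEnoughRootsOfUnity ℂ q]
  have := (Complex.abs_re_le_norm _).trans hbound
  rw [abs_le] at this
  linarith

end TwistedLogSums

section VonMangoldtLogTermBounds

open Finset
open scoped Topology

/-- Mertens' first theorem on the range `exp (T / 2) < p ≤ exp T`. -/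
theorem eventually_le_sum_log_prime_div :
    ∀ᶠ T : ℝ in atTop, T / 4 ≤
      ∑ p ∈ Ioc ⌊Real.exp (T / 2)⌋₊ ⌊Real.exp T⌋₊ with p.Prime, Real.log p / p := by
  obtain ⟨C, hC⟩ := exists_abs_sum_log_prime_div_sub_log_le
  filter_upwards [eventually_ge_atTop (4 + 8 * C), eventually_ge_atTop 0] with T hT hT0
  set N₁ := ⌊Real.exp (T / 2)⌋₊ with hN₁
  set N₂ := ⌊Real.exp T⌋₊ with hN₂
  have hle : N₁ ≤ N₂ := Nat.floor_mono (Real.exp_le_exp.mpr (by linarith))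
  have h1 : 1 ≤ N₁ := Nat.one_le_floor_iff _ |>.mpr (Real.one_le_exp (by linarith))
  have hlog1 : Real.log N₁ ≤ T / 2 := by
    rw [Real.log_le_iff_le_exp (by exact_mod_cast h1)]
    exact Nat.floor_le (Real.exp_pos _).le
  have hlog2 : T - 1 ≤ Real.log N₂ := by
    rw [Real.le_log_iff_exp_le (by exact_mod_cast h1.trans hle), Real.exp_sub]
    have h2 := Nat.lt_floor_add_one (Real.exp T)
    have h3 : (1 : ℝ) ≤ N₂ := by exact_mod_cast h1.trans hle
    rw [div_le_iff₀ (Real.exp_pos 1)]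
    have h4 := Real.add_one_le_exp 1
    nlinarith
  have h2 := abs_le.mp (hC N₁ h1)
  have h3 := abs_le.mp (hC N₂ (h1.trans hle))
  have h4 : ∑ p ∈ Ioc 0 N₁ with p.Prime, Real.log p / p +
      ∑ p ∈ Ioc N₁ N₂ with p.Prime, Real.log p / p =
      ∑ p ∈ Ioc 0 N₂ with p.Prime, Real.log p / p := by
    simp_rw [sum_filter]
    exact sum_Ioc_consecutive _ (Nat.zero_le _) hle
  linarith

theorem eventually_le_tsum_coprime_vonMangoldtLogTerm :
    ∀ᶠ T : ℝ in atTop, ∀ (k q : ℕ) [NeZero q], q.Prime → (q : ℝ) ≤ Real.exp (T / 2) →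
      (T / 12) ^ (k + 1) ≤
        ∑' n : ℕ, if IsUnit (n : ZMod q) then vonMangoldtLogTerm k T⁻¹ n else 0 := by
  filter_upwards [eventually_le_sum_log_prime_div, eventually_gt_atTop 0]
    with T hT hT0 k q _ hq hqT
  have hnonneg (n : ℕ) : 0 ≤ if IsUnit (n : ZMod q) then vonMangoldtLogTerm k T⁻¹ n else 0 := by
    split_ifs
    exacts [vonMangoldtLogTerm_nonneg _ _ _, le_rfl]
  have hsummable : Summable fun n : ℕ =>
      if IsUnit (n : ZMod q) then vonMangoldtLogTerm k T⁻¹ n else 0 := by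
    refine Summable.of_nonneg_of_le hnonneg (fun n => ?_)
      (summable_vonMangoldtLogTerm k (inv_pos.mpr hT0))
    split_ifs
    exacts [le_rfl, vonMangoldtLogTerm_nonneg _ _ _]
  refine le_trans ?_ (hsummable.sum_le_tsum
    {p ∈ Ioc ⌊Real.exp (T / 2)⌋₊ ⌊Real.exp T⌋₊ | p.Prime} fun n _ => hnonneg n)
  calc (T / 12) ^ (k + 1) = (T / 12) ^ k * (T / 12) := pow_succ _ _
    _ ≤ (T / 2) ^ k * (T / 12) := by gcongr; norm_num
    _ = (T / 2) ^ k / 3 * (T / 4) := by ring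
    _ ≤ (T / 2) ^ k / 3 *
        ∑ p ∈ Ioc ⌊Real.exp (T / 2)⌋₊ ⌊Real.exp T⌋₊ with p.Prime, Real.log p / p := by gcongr
    _ ≤ _ := by
      rw [mul_sum]
      refine sum_le_sum fun p hp => ?_
      obtain ⟨hp, hpp⟩ := mem_filter.mp hp
      obtain ⟨hp1, hp2⟩ := mem_Ioc.mp hp
      have hp0 : (0 : ℝ) < p := by exact_mod_cast hpp.pos
      have hpl : Real.exp (T / 2) < p := Nat.lt_of_floor_lt hp1
      have hpu : (p : ℝ) ≤ Real.exp T := (Nat.le_floor_iff (Real.exp_pos _).le).mp hp2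
      have hunit : IsUnit (p : ZMod q) := by
        rw [ZMod.isUnit_iff_coprime, Nat.coprime_primes hpp hq]
        rintro rfl
        linarith
      have hlog : T / 2 ≤ Real.log p := ((Real.lt_log_iff_exp_lt hp0).mpr hpl).le
      have hrpow : (p : ℝ) ^ T⁻¹ ≤ 3 := by
        calc (p : ℝ) ^ T⁻¹ ≤ Real.exp T ^ T⁻¹ := by gcongr
          _ = Real.exp 1 := by rw [← Real.exp_mul, mul_inv_cancel₀ hT0.ne']
          _ ≤ 3 := by linarith [Real.exp_one_lt_d9]
      rw [if_pos hunit, vonMangoldtLogTerm, ArithmeticFunction.vonMangoldt_apply_prime hpp,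
        Real.rpow_add hp0, Real.rpow_one]
      have hlog0 : 0 ≤ Real.log p := by linarith
      calc (T / 2) ^ k / 3 * (Real.log p / p) ≤
          Real.log p ^ k / (p : ℝ) ^ T⁻¹ * (Real.log p / p) := by gcongr
        _ = _ := by field_simp

theorem vonMangoldtLogTerm_le (k : ℕ) {η L : ℝ} (hη : 0 < η) {n : ℕ} (hn : n ≠ 0)
    (hL : L ≤ Real.log n) :
    vonMangoldtLogTerm k η n ≤ (k + 1).factorial * (4 / η) ^ (k + 1) * Real.exp (-(η * L / 4)) *
      (1 / (n : ℝ) ^ (1 + η / 2)) := by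
  have hn0 : (0 : ℝ) < n := by positivity
  have hlog := Real.log_natCast_nonneg n
  have h1 := Real.pow_div_factorial_le_exp (η / 4 * Real.log n) (by positivity) (k + 1)
  have h2 : Real.exp (η * L / 4) ≤ Real.exp (η / 4 * Real.log n) := by
    rw [Real.exp_le_exp]
    nlinarith
  have h3 : (n : ℝ) ^ (1 + η) = (n : ℝ) ^ (1 + η / 2) *
      (Real.exp (η / 4 * Real.log n) * Real.exp (η / 4 * Real.log n)) := by
    rw [Real.rpow_def_of_pos hn0, Real.rpow_def_of_pos hn0, ← Real.exp_add, ← Real.exp_add]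
    congr 1
    ring
  have h4 : Real.log n ^ (k + 1) ≤
      (k + 1).factorial * (4 / η) ^ (k + 1) * Real.exp (η / 4 * Real.log n) := by
    rw [div_le_iff₀ (by positivity)] at h1
    calc Real.log n ^ (k + 1) = (4 / η) ^ (k + 1) * (η / 4 * Real.log n) ^ (k + 1) := by
          rw [← mul_pow]
          congr 1
          field_simp
      _ ≤ (4 / η) ^ (k + 1) * (Real.exp (η / 4 * Real.log n) * (k + 1).factorial) := by gcongr
      _ = _ := by ring
  rw [vonMangoldtLogTerm, h3, Real.exp_neg]
  calc _ ≤ Real.log n * Real.log n ^ k / ((n : ℝ) ^ (1 + η / 2) *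
        (Real.exp (η / 4 * Real.log n) * Real.exp (η / 4 * Real.log n))) := by
        gcongr
        exact ArithmeticFunction.vonMangoldt_le_log
    _ ≤ ((k + 1).factorial * (4 / η) ^ (k + 1) * Real.exp (η / 4 * Real.log n)) /
        ((n : ℝ) ^ (1 + η / 2) *
          (Real.exp (η / 4 * Real.log n) * Real.exp (η * L / 4))) := by
        rw [← pow_succ']
        gcongr
    _ = _ := by field_simp

theorem vonMangoldtLogTerm_le_pow (k : ℕ) {η : ℝ} (hη : 0 ≤ η) {n : ℕ} (hn : n ≠ 0) :
    vonMangoldtLogTerm k η n ≤ Real.log n ^ (k + 1) := by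
  have hlog := Real.log_natCast_nonneg n
  have h1 : 1 ≤ (n : ℝ) ^ (1 + η) :=
    Real.one_le_rpow (by exact_mod_cast Nat.one_le_iff_ne_zero.mpr hn) (by linarith)
  rw [vonMangoldtLogTerm, pow_succ']
  refine (div_le_self (mul_nonneg ArithmeticFunction.vonMangoldt_nonneg (by positivity)) h1).trans
    ?_
  gcongr
  exact ArithmeticFunction.vonMangoldt_le_log

theorem summable_vonMangoldt_nonprime_mul_log_pow_div (k : ℕ) :
    Summable fun n : ℕ =>
      (if n.Prime then 0 else ArithmeticFunction.vonMangoldt n) * Real.log n ^ k / n := by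
  set f : ℕ → ℝ := fun n => if n.Prime then 0 else ArithmeticFunction.vonMangoldt n with hf
  have hf0 (n : ℕ) : 0 ≤ f n := by
    simp only [hf]
    split_ifs
    exacts [le_rfl, ArithmeticFunction.vonMangoldt_nonneg]
  have hsum (n : ℕ) : ∑ j ∈ Icc 1 n, f j = Chebyshev.psi n - Chebyshev.theta n := by
    rw [Chebyshev.psi, Chebyshev.theta, Nat.floor_natCast, sum_filter, ← sum_sub_distrib]
    refine sum_congr rfl fun j _ => ?_
    simp only [hf]
    split_ifs with h
    · rw [ArithmeticFunction.vonMangoldt_apply_prime h, sub_self]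
    · rw [sub_zero]
  obtain ⟨C, hC⟩ := Chebyshev.psi_sub_theta_le_mul_sqrt
  have hO : (fun n => ∑ j ∈ Icc 1 n, f j) =O[atTop] fun n => (n : ℝ) ^ (1 / 2 : ℝ) := by
    refine Asymptotics.IsBigO.of_bound C (Eventually.of_forall fun n => ?_)
    rw [Real.norm_of_nonneg (sum_nonneg fun j _ => hf0 j), Real.norm_of_nonneg (by positivity),
      hsum, ← Real.sqrt_eq_rpow]
    exact hC n
  have habs : LSeries.abscissaOfAbsConv (fun n => (f n : ℂ)) ≤ (1 / 2 : ℝ) :=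
    LSeries.abscissaOfAbsConv_le_of_forall_lt_LSeriesSummable fun y hy =>
      LSeriesSummable_of_sum_norm_bigO_and_nonneg hO hf0 (by norm_num) (by simpa using hy)
  have hs : LSeriesSummable (LSeries.logMul^[k] fun n => (f n : ℂ)) 1 := by
    refine LSeriesSummable_of_abscissaOfAbsConv_lt_re ?_
    rw [LSeries.absicssaOfAbsConv_logPowMul]
    refine habs.trans_lt ?_
    rw [Complex.one_re]
    exact_mod_cast (by norm_num : (1 / 2 : ℝ) < 1)
  refine Complex.summable_ofReal.mp (hs.congr fun n => ?_)
  rcases eq_or_ne n 0 with rfl | hn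
  · simp
  · rw [LSeries.term_of_ne_zero hn, logMul_iterate_apply, Complex.cpow_one]
    change _ = ((f n * Real.log n ^ k / n : ℝ) : ℂ)
    push_cast
    ring

theorem vonMangoldtLogTerm_le_of_not_prime (k : ℕ) {η : ℝ} (hη : 0 ≤ η) {n : ℕ}
    (hn : ¬ n.Prime) : vonMangoldtLogTerm k η n ≤
      (if n.Prime then 0 else ArithmeticFunction.vonMangoldt n) * Real.log n ^ k / n := by
  rw [if_neg hn, vonMangoldtLogTerm]
  rcases eq_or_ne n 0 with rfl | hn
  · simp
  · have h1 : (1 : ℝ) ≤ n := by exact_mod_cast Nat.one_le_iff_ne_zero.mpr hn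
    gcongr
    calc (n : ℝ) = (n : ℝ) ^ (1 : ℝ) := (Real.rpow_one _).symm
      _ ≤ _ := Real.rpow_le_rpow_of_exponent_le h1 (by linarith)

theorem tsum_one_div_rpow_eq_norm_riemannZeta {η : ℝ} (hη : 0 < η) :
    ∑' n : ℕ, 1 / (n : ℝ) ^ (1 + η) = ‖riemannZeta (1 + η)‖ := by
  rw [zeta_eq_tsum_one_div_nat_cpow (by simpa)]
  have h (n : ℕ) : 1 / (n : ℂ) ^ (1 + η : ℂ) = ((1 / (n : ℝ) ^ (1 + η) : ℝ) : ℂ) := by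
    push_cast
    rw [Complex.ofReal_cpow (Nat.cast_nonneg n)]
    push_cast
    rfl
  simp_rw [h]
  rw [← Complex.ofReal_tsum, Complex.norm_real,
    Real.norm_of_nonneg (tsum_nonneg fun n => by positivity)]

end VonMangoldtLogTermBounds

section PrimeCongruentNegOne

open Finset
open scoped Topology

/-- Upper bound for the part of the sum over `n ≡ a` that does not come from primes in
`(B ^ k, exp (B ^ 5)]`. -/
theorem exists_eventually_tsum_residueClass_le (k : ℕ) :
    ∃ K : ℝ, 0 ≤ K ∧ ∀ᶠ B : ℝ in atTop, ∀ (q : ℕ) (a : ZMod q),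
      (∀ p : ℕ, p.Prime → (p : ZMod q) = a → B ^ k < p → B ^ 5 < Real.log p) →
      ∑' n : ℕ, (if (n : ZMod q) = a then vonMangoldtLogTerm k (B ^ 4)⁻¹ n else 0) ≤
        K * B ^ (3 * k + 2) := by
  have hh := summable_vonMangoldt_nonprime_mul_log_pow_div k
  set h : ℕ → ℝ := fun n =>
    (if n.Prime then 0 else ArithmeticFunction.vonMangoldt n) * Real.log n ^ k / n with hhdef
  have hh0 (n : ℕ) : 0 ≤ h n := by
    have := Real.log_natCast_nonneg n
    have : 0 ≤ if n.Prime then 0 else ArithmeticFunction.vonMangoldt n := by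
      split_ifs
      exacts [le_rfl, ArithmeticFunction.vonMangoldt_nonneg]
    positivity
  set D : ℝ := (k + 1).factorial * 4 ^ (k + 2) with hD
  have hD0 : 0 ≤ D := by positivity
  refine ⟨(k : ℝ) ^ (k + 1) + ∑' n, h n + D, by
    have : 0 ≤ ∑' n, h n := tsum_nonneg hh0
    positivity, ?_⟩
  have hη : Tendsto (fun B : ℝ => (B ^ 4)⁻¹ / 2) atTop (𝓝[>] 0) := by
    refine tendsto_nhdsWithin_iff.mpr ⟨?_, ?_⟩
    · simpa using (tendsto_inv_atTop_zero.comp (tendsto_pow_atTop (n := 4) (by norm_num))).div_const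
        (2 : ℝ)
    · filter_upwards [eventually_gt_atTop 0] with B hB
      exact Set.mem_Ioi.mpr (by positivity)
  have hexp : ∀ᶠ B : ℝ in atTop, B ^ (4 * k + 8) * Real.exp (-(B / 4)) ≤ 1 := by
    have h1 := (tendsto_id.atTop_div_const (show (0 : ℝ) < 4 by norm_num))
    have h2 := ((Real.tendsto_pow_mul_exp_neg_atTop_nhds_zero (4 * k + 8)).comp h1).const_mul
      ((4 : ℝ) ^ (4 * k + 8))
    rw [mul_zero] at h2
    filter_upwards [h2.eventually (ge_mem_nhds one_pos)] with B hB
    simp only [Function.comp_apply, id] at hB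
    rwa [← mul_assoc, ← mul_pow, mul_div_cancel₀ B (by norm_num)] at hB
  filter_upwards [hη.eventually eventually_norm_riemannZeta_one_add_le, hexp,
    eventually_ge_atTop 1] with B hζ hexp hB1 q a hp
  have hB0 : 0 < B := by linarith
  set η := (B ^ 4)⁻¹ with hηdef
  have hη0 : 0 < η := by positivity
  set c : ℝ := (k + 1).factorial * (4 / η) ^ (k + 1) * Real.exp (-(η * B ^ 5 / 4)) with hc
  have hc0 : 0 ≤ c := by positivity
  set N := ⌊B ^ k⌋₊ with hN
  have hu1 : HasSum (fun n : ℕ => if n ∈ Ioc 0 N then (k * B) ^ (k + 1) else 0)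
      (∑ n ∈ Ioc 0 N, (k * B) ^ (k + 1)) := by
    have := hasSum_sum_of_ne_finset_zero (s := Ioc 0 N) (L := .unconditional ℕ)
      (f := fun n : ℕ => if n ∈ Ioc 0 N then (k * B) ^ (k + 1) else 0)
      (fun n hn => if_neg hn)
    rwa [sum_congr rfl fun n hn => if_pos hn] at this
  have hz : Summable fun n : ℕ => 1 / (n : ℝ) ^ (1 + η / 2) :=
    Real.summable_one_div_nat_rpow.mpr (by linarith)
  have hterm (n : ℕ) : (if (n : ZMod q) = a then vonMangoldtLogTerm k η n else 0) ≤
      (if n ∈ Ioc 0 N then (k * B) ^ (k + 1) else 0) + h n + c * (1 / (n : ℝ) ^ (1 + η / 2)) := by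
    have e1 : (0 : ℝ) ≤ if n ∈ Ioc 0 N then (k * B) ^ (k + 1) else 0 := by positivity
    have e2 := hh0 n
    have e3 : 0 ≤ c * (1 / (n : ℝ) ^ (1 + η / 2)) := by positivity
    split_ifs with ha hn hn
    · have hn' := mem_Ioc.mp hn
      have hn0 : (0 : ℝ) < n := by exact_mod_cast hn'.1
      have h1 := vonMangoldtLogTerm_le_pow k hη0.le hn'.1.ne'
      have h2 : Real.log n ≤ k * B := by
        have h3 : (n : ℝ) ≤ B ^ k := (Nat.le_floor_iff (by positivity)).mp hn'.2
        calc Real.log n ≤ Real.log (B ^ k) := Real.log_le_log hn0 h3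
          _ = k * Real.log B := Real.log_pow _ _
          _ ≤ k * B := by gcongr; exact Real.log_le_self hB0.le
      have h3 : Real.log n ^ (k + 1) ≤ (k * B) ^ (k + 1) :=
        pow_le_pow_left₀ (Real.log_natCast_nonneg n) h2 _
      linarith
    · by_cases hpr : n.Prime
      · have h1 : B ^ k < n := by
          by_contra! hle
          exact hn (mem_Ioc.mpr ⟨hpr.pos, Nat.le_floor hle⟩)
        have h2 := vonMangoldtLogTerm_le k hη0 hpr.ne_zero (hp n hpr ha h1).le
        linarith
      · have := vonMangoldtLogTerm_le_of_not_prime k hη0.le hpr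
        simp only [hhdef] at e2 ⊢
        linarith
    · positivity
    · positivity
  have hsum := ((hu1.add hh.hasSum).add (hz.hasSum.mul_left c))
  have hlhs : Summable fun n : ℕ => if (n : ZMod q) = a then vonMangoldtLogTerm k η n else 0 := by
    refine Summable.of_nonneg_of_le (fun n => ?_) hterm hsum.summable
    split_ifs
    exacts [vonMangoldtLogTerm_nonneg _ _ _, le_rfl]
  have hle := hasSum_le hterm hlhs.hasSum hsum
  have hpow {m : ℕ} (hm : m ≤ 3 * k + 2) : B ^ m ≤ B ^ (3 * k + 2) := pow_le_pow_right₀ hB1 hm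
  have b1 : ∑ n ∈ Ioc 0 N, (k * B) ^ (k + 1) ≤ (k : ℝ) ^ (k + 1) * B ^ (3 * k + 2) := by
    rw [sum_const, Nat.card_Ioc, nsmul_eq_mul, Nat.sub_zero]
    calc (N : ℝ) * (k * B) ^ (k + 1) ≤ B ^ k * (k * B) ^ (k + 1) := by
          gcongr
          exact Nat.floor_le (by positivity)
      _ = (k : ℝ) ^ (k + 1) * B ^ (2 * k + 1) := by ring
      _ ≤ _ := mul_le_mul_of_nonneg_left (hpow (by omega)) (by positivity)
  have b2 : ∑' n, h n ≤ (∑' n, h n) * B ^ (3 * k + 2) :=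
    le_mul_of_one_le_right (tsum_nonneg hh0) (one_le_pow₀ hB1)
  have b3 : c * ∑' n : ℕ, 1 / (n : ℝ) ^ (1 + η / 2) ≤ D * B ^ (3 * k + 2) := by
    have h1 : ∑' n : ℕ, 1 / (n : ℝ) ^ (1 + η / 2) ≤ 2 / (η / 2) := by
      rw [tsum_one_div_rpow_eq_norm_riemannZeta (by positivity)]
      exact hζ
    have h2 : η * B ^ 5 / 4 = B / 4 := by rw [hηdef]; field_simp
    calc _ ≤ c * (2 / (η / 2)) := by gcongr
      _ = D * (B ^ (4 * k + 8) * Real.exp (-(B / 4))) := by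
        rw [hc, h2, hD, hηdef, div_inv_eq_mul]
        field_simp
        ring
      _ ≤ D * 1 := by gcongr
      _ ≤ D * B ^ (3 * k + 2) := by gcongr; exact one_le_pow₀ hB1
  calc _ ≤ _ := hle
    _ ≤ _ := by linarith

/-- A Linnik-type statement: if no `L`-function modulo the prime `q` is exceptionally small at
`1`, then there is a moderately large prime congruent to `-1` modulo `q`. -/
theorem eventually_exists_prime_eq_neg_one (k : ℕ) :
    ∀ᶠ B : ℝ in atTop, ∀ (q : ℕ) [NeZero q], q.Prime → (q : ℝ) ≤ B ^ k →
      (∀ χ : DirichletCharacter ℂ q, χ ≠ 1 → B⁻¹ ≤ ‖DirichletCharacter.LFunction χ 1‖ ∧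
        ∀ s : ℂ, ‖s - 1‖ ≤ (B ^ 3)⁻¹ → ‖deriv (DirichletCharacter.LFunction χ) s‖ ≤ B) →
      ∃ p : ℕ, p.Prime ∧ (p : ZMod q) = -1 ∧ B ^ k < p ∧ Real.log p ≤ B ^ 5 := by
  obtain ⟨K, hK0, hK⟩ := exists_eventually_tsum_residueClass_le k
  set K' : ℝ := 12 ^ (k + 1) * (2 ^ (k + 1) * k.factorial + K) with hK'
  have hexp : ∀ᶠ B : ℝ in atTop, B ^ k * Real.exp (-B) ≤ 1 :=
    (Real.tendsto_pow_mul_exp_neg_atTop_nhds_zero k).eventually (ge_mem_nhds one_pos)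
  filter_upwards [hK, hexp, eventually_ge_atTop 2, eventually_gt_atTop K',
    (tendsto_pow_atTop (n := 4) (by norm_num)).eventually
      eventually_le_tsum_coprime_vonMangoldtLogTerm] with B hK hexp hB2 hBK hlow q _ hq hqB hχ
  have hB0 : 0 < B := by linarith
  by_contra! hcon
  have h1 := hK q (-1) hcon
  have hqexp : (q : ℝ) ≤ Real.exp (B ^ 4 / 2) := by
    rw [Real.exp_neg, ← div_eq_mul_inv, div_le_one (Real.exp_pos _)] at hexp
    refine hqB.trans (hexp.trans (Real.exp_le_exp.mpr ?_))
    nlinarith [pow_le_pow_left₀ zero_le_two hB2 3]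
  have h2 := hlow k q hq hqexp
  have h3 := tsum_coprime_sub_le_totient_mul_tsum_residueClass (q := q) (a := -1)
    isUnit_one.neg (vonMangoldtLogTerm_nonneg k (B ^ 4)⁻¹)
    (summable_vonMangoldtLogTerm k (by positivity))
    (M := 2 ^ (k + 1) * k.factorial * B ^ (3 * k + 2)) (by positivity)
    fun χ h => norm_tsum_mul_vonMangoldtLogTerm_le h hB2 (hχ χ h).1 (hχ χ h).2 k
  have h4 : (q.totient : ℝ) ≤ B ^ k := le_trans (by exact_mod_cast Nat.totient_le q) hqB
  have h5 : (B ^ 4 / 12) ^ (k + 1) ≤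
      B ^ k * ((2 ^ (k + 1) * k.factorial + K) * B ^ (3 * k + 2)) := by
    calc (B ^ 4 / 12) ^ (k + 1) ≤ q.totient * ((2 ^ (k + 1) * k.factorial + K) *
          B ^ (3 * k + 2)) := by
          have := mul_le_mul_of_nonneg_left h1 (Nat.cast_nonneg (α := ℝ) q.totient)
          linarith
      _ ≤ _ := by gcongr
  rw [div_pow, div_le_iff₀ (by positivity)] at h5
  have h6 : K' * B ^ (4 * k + 2) < (B ^ 4) ^ (k + 1) := by
    calc K' * B ^ (4 * k + 2) < B * B ^ (4 * k + 2) := by gcongr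
      _ = B ^ (4 * k + 3) := by ring
      _ ≤ B ^ (4 * k + 4) := pow_le_pow_right₀ (by linarith) (by omega)
      _ = (B ^ 4) ^ (k + 1) := by ring
  have h7 : B ^ k * ((2 ^ (k + 1) * k.factorial + K) * B ^ (3 * k + 2)) * 12 ^ (k + 1) =
      K' * B ^ (4 * k + 2) := by rw [hK']; ring
  linarith

end PrimeCongruentNegOne

section UpperBound

open Finset
open scoped Topology

/-- Up to one large exceptional modulus, all primes `q ≤ y` divide `p + 1` for some prime `p` with
`y ^ 2 < p` and `log p ≤ y ^ (5 * δ)`. -/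
theorem eventually_exists_exceptional_prime {δ : ℝ} (hδ : 0 < δ) (Q : ℕ) :
    ∀ᶠ y : ℝ in atTop, ∃ q₀ : ℕ, Q < q₀ ∧ ∀ q : ℕ, q.Prime → (q : ℝ) ≤ y → q ≠ q₀ →
      ∃ p : ℕ, p.Prime ∧ q ∣ p + 1 ∧ y ^ 2 < p ∧ Real.log p ≤ y ^ (5 * δ) := by
  obtain ⟨k, hk⟩ := exists_nat_ge (2 / δ)
  rw [div_le_iff₀ hδ] at hk
  obtain ⟨κ, hκ, hL⟩ := exists_eventually_norm_LFunction_le hδ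
  have hB := tendsto_rpow_atTop hδ
  have hB3 : Tendsto (fun y : ℝ => ((y ^ δ) ^ 3)⁻¹) atTop (𝓝 0) :=
    tendsto_inv_atTop_zero.comp ((tendsto_pow_atTop (by norm_num)).comp hB)
  filter_upwards [hL, hB3.eventually (ge_mem_nhds hκ),
    hB.eventually (eventually_exists_prime_eq_neg_one k), eventually_exceptional_prime_unique hδ,
    eventually_rpow_neg_le_norm_LFunction_one hδ Q, eventually_ge_atTop 1]
    with y hL hκy hprime hunique hQ hy1
  have hy0 : 0 < y := by linarith
  have hyk : y ^ 2 ≤ (y ^ δ) ^ k := by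
    rw [← Real.rpow_natCast, ← Real.rpow_natCast, ← Real.rpow_mul hy0.le]
    exact Real.rpow_le_rpow_of_exponent_le hy1 (by push_cast; linarith)
  have hgood (q : ℕ) (hq : q.Prime) (hqy : (q : ℝ) ≤ y)
      (h : ∀ [NeZero q], ∀ χ : DirichletCharacter ℂ q, χ ≠ 1 →
        y ^ (-δ) ≤ ‖DirichletCharacter.LFunction χ 1‖) :
      ∃ p : ℕ, p.Prime ∧ q ∣ p + 1 ∧ y ^ 2 < p ∧ Real.log p ≤ y ^ (5 * δ) := by
    have := NeZero.mk hq.ne_zero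
    have hqy2 : (q : ℝ) ≤ y ^ 2 := by nlinarith
    obtain ⟨p, hp, hpq, hpy, hplog⟩ := hprime q hq (hqy2.trans hyk) fun χ hχ => by
      refine ⟨?_, fun s hs => (hL q hqy2 χ hχ s (hs.trans hκy)).2⟩
      rw [← Real.rpow_neg hy0.le]
      exact h χ hχ
    refine ⟨p, hp, ?_, hyk.trans_lt hpy, hplog.trans_eq ?_⟩
    · rw [← ZMod.natCast_eq_zero_iff]
      push_cast
      rw [hpq, neg_add_cancel]
    · rw [← Real.rpow_natCast, ← Real.rpow_mul hy0.le, mul_comm]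
      norm_num
  by_cases hex : ∃ q₀ : ℕ, q₀.Prime ∧ (q₀ : ℝ) ≤ y ∧ ∃ _ : NeZero q₀,
      ∃ χ : DirichletCharacter ℂ q₀, χ ≠ 1 ∧ ‖DirichletCharacter.LFunction χ 1‖ < y ^ (-δ)
  · obtain ⟨q₀, hq₀, hq₀y, _, χ₀, hχ₀, hχ₀L⟩ := hex
    refine ⟨q₀, ?_, fun q hq hqy hne => hgood q hq hqy fun χ hχ => ?_⟩
    · by_contra! hle
      exact absurd (hQ q₀ hle χ₀ hχ₀) hχ₀L.not_ge
    · by_contra! hlt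
      exact hne (hunique q q₀ hq hq₀ hqy hq₀y χ χ₀ hχ hχ₀ hlt hχ₀L)
  · push Not at hex
    exact ⟨Q + 1, Nat.lt_succ_self Q, fun q hq hqy _ => hgood q hq hqy
      fun χ hχ => hex q hq hqy inferInstance χ hχ⟩

theorem dedekindPsi_prod_primes {S : Finset ℕ} (hS : ∀ p ∈ S, p.Prime) :
    dedekindPsi (∏ p ∈ S, p) = ∏ p ∈ S, (p + 1) := by
  have hfac (p : ℕ) (hp : p ∈ S) : (∏ p ∈ S, p).factorization p = 1 := by
    rw [Nat.factorization_prod_apply fun q hq => (hS q hq).ne_zero,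
      Finset.sum_eq_single_of_mem p hp fun q hq hne =>
        Nat.factorization_eq_zero_of_not_dvd fun h =>
          hne ((Nat.prime_dvd_prime_iff_eq (hS p hp) (hS q hq)).mp h).symm,
      (hS p hp).factorization_self]
  rw [dedekindPsi, Finsupp.prod, Nat.support_factorization, Nat.primeFactors_prod hS]
  refine prod_congr rfl fun p hp => ?_
  rw [hfac p hp, Nat.sub_self, pow_zero, one_mul]

theorem exp_neg_mertensWeight {p : ℕ} (hp : p.Prime) :
    Real.exp (-mertensWeight p) = 1 - (p : ℝ)⁻¹ := by
  have := inv_prime_le_half hp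
  rw [mertensWeight, if_pos hp, neg_neg, Real.exp_log (by linarith)]

theorem totient_div_le_prod_one_sub_inv {m : ℕ} (hm : m ≠ 0) {P : Finset ℕ}
    (hP : ∀ p ∈ P, p.Prime ∧ p ∣ m) : (m.totient : ℝ) / m ≤ ∏ p ∈ P, (1 - (p : ℝ)⁻¹) := by
  rw [totient_div_eq_exp_sum_mertensWeight hm,
    ← prod_congr rfl fun p hp => exp_neg_mertensWeight (hP p hp).1, ← Real.exp_sum,
    sum_neg_distrib, Real.exp_le_exp, neg_le_neg_iff]
  exact sum_le_sum_of_subset_of_nonneg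
    (fun p hp => Nat.mem_primeFactors.mpr ⟨(hP p hp).1, (hP p hp).2, hm⟩)
    fun p _ _ => mertensWeight_nonneg p

/-- Removing one prime from the Mertens product. -/
theorem prod_erase_one_sub_inv_le {P : Finset ℕ} (hP : ∀ p ∈ P, p.Prime) {Q q₀ : ℕ} (hQ : 0 < Q)
    (hq₀ : Q < q₀) :
    ∏ p ∈ P.erase q₀, (1 - (p : ℝ)⁻¹) ≤ (1 + (Q : ℝ)⁻¹) * ∏ p ∈ P, (1 - (p : ℝ)⁻¹) := by
  have hQ0 : (0 : ℝ) < Q := by exact_mod_cast hQ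
  have hpos : ∀ R ⊆ P, 0 ≤ ∏ p ∈ R, (1 - (p : ℝ)⁻¹) := fun R hR =>
    prod_nonneg fun p hp => by linarith [inv_prime_le_half (hP p (hR hp))]
  by_cases h : q₀ ∈ P
  · rw [← mul_prod_erase P _ h, ← mul_assoc]
    refine le_mul_of_one_le_left (hpos _ (erase_subset _ _)) ?_
    have h1 : (q₀ : ℝ)⁻¹ ≤ ((Q : ℝ) + 1)⁻¹ := by
      gcongr
      exact_mod_cast hq₀
    calc (1 : ℝ) = (1 + (Q : ℝ)⁻¹) * (1 - ((Q : ℝ) + 1)⁻¹) := by field_simp; ring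
      _ ≤ _ := by gcongr
  · rw [erase_eq_of_notMem h]
    exact le_mul_of_one_le_left (hpos P Subset.rfl) (by linarith [inv_pos.mpr hQ0])

theorem prod_add_one_div_prod_le {S : Finset ℕ} {x : ℝ} (hx : 0 < x) (hS : ∀ p ∈ S, x < (p : ℝ)) :
    ((∏ p ∈ S, (p + 1) : ℕ) : ℝ) / (∏ p ∈ S, p : ℕ) ≤ Real.exp (#S / x) := by
  push_cast
  rw [← prod_div_distrib]
  calc ∏ p ∈ S, ((p : ℝ) + 1) / p ≤ ∏ _p ∈ S, Real.exp (1 / x) := by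
        refine prod_le_prod (fun p _ => by positivity) fun p hp => ?_
        have hp0 : (0 : ℝ) < p := hx.trans (hS p hp)
        calc ((p : ℝ) + 1) / p = 1 / p + 1 := by field_simp; ring
          _ ≤ Real.exp (1 / p) := Real.add_one_le_exp _
          _ ≤ Real.exp (1 / x) := by
            rw [Real.exp_le_exp]
            exact one_div_le_one_div_of_le hx (hS p hp).le
    _ = Real.exp (#S / x) := by
      rw [prod_const, ← Real.exp_nat_mul]
      congr 1
      ring

theorem eventually_exists_totient_dedekindPsi_mul_log_log_div_le {δ : ℝ} (hδ : 0 < δ) {Q : ℕ}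
    (hQ : 0 < Q) :
    ∀ᶠ y : ℝ in atTop, ∃ n : ℕ, y ≤ n ∧
      (dedekindPsi n).totient * Real.log (Real.log n) / n ≤
        Real.exp (1 / y) * (1 + (Q : ℝ)⁻¹) * (1 + 5 * δ) *
          ((∏ p ∈ Ioc 0 ⌊y⌋₊ with p.Prime, (1 - (p : ℝ)⁻¹)) * Real.log y) := by
  filter_upwards [eventually_exists_exceptional_prime hδ Q, eventually_ge_atTop 3]
    with y ⟨q₀, hq₀, hf⟩ hy3
  have hy0 : 0 < y := by linarith
  set P := {p ∈ Ioc 0 ⌊y⌋₊ | p.Prime} with hPdef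
  have hP (p : ℕ) (hp : p ∈ P) : p.Prime := (mem_filter.mp hp).2
  have hmem {q : ℕ} (hq : q ∈ P.erase q₀) : q.Prime ∧ (q : ℝ) ≤ y ∧ q ≠ q₀ := by
    obtain ⟨hne, hqP⟩ := mem_erase.mp hq
    obtain ⟨hqI, hqp⟩ := mem_filter.mp hqP
    exact ⟨hqp, (Nat.le_floor_iff hy0.le).mp (mem_Ioc.mp hqI).2, hne⟩
  choose! f hf using fun q hq => hf q (hmem hq).1 (hmem hq).2.1 (hmem hq).2.2
  set S := (P.erase q₀).image f with hSdef
  have hS (p : ℕ) (hp : p ∈ S) : p.Prime ∧ y ^ 2 < p ∧ Real.log p ≤ y ^ (5 * δ) := by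
    obtain ⟨q, hq, rfl⟩ := mem_image.mp hp
    exact ⟨(hf q hq).1, (hf q hq).2.2⟩
  have hcard : (#S : ℝ) ≤ y := by
    have h1 : #S ≤ ⌊y⌋₊ := by
      calc #S ≤ #(P.erase q₀) := card_image_le
        _ ≤ #P := card_erase_le
        _ ≤ #(Ioc 0 ⌊y⌋₊) := card_filter_le _ _
        _ = ⌊y⌋₊ := by rw [Nat.card_Ioc, Nat.sub_zero]
    exact (Nat.cast_le.mpr h1).trans (Nat.floor_le hy0.le)
  have hSne : S.Nonempty := by
    have h2 : 2 ∈ P := mem_filter.mpr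
      ⟨mem_Ioc.mpr ⟨by norm_num, Nat.le_floor (by push_cast; linarith)⟩, Nat.prime_two⟩
    have h3 : 3 ∈ P := mem_filter.mpr
      ⟨mem_Ioc.mpr ⟨by norm_num, Nat.le_floor (by push_cast; linarith)⟩, Nat.prime_three⟩
    refine Nonempty.image ?_ f
    rcases eq_or_ne 2 q₀ with h | h
    · exact ⟨3, mem_erase.mpr ⟨by omega, h3⟩⟩
    · exact ⟨2, mem_erase.mpr ⟨h, h2⟩⟩
  set n := ∏ p ∈ S, p with hn
  have hn0 : n ≠ 0 := prod_ne_zero_iff.mpr fun p hp => (hS p hp).1.ne_zero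
  have hn0' : (0 : ℝ) < n := by positivity
  have hψ : dedekindPsi n = ∏ p ∈ S, (p + 1) := dedekindPsi_prod_primes fun p hp => (hS p hp).1
  have hψ0 : dedekindPsi n ≠ 0 := (Nat.pos_of_ne_zero hn0 |>.trans_le (le_dedekindPsi hn0)).ne'
  have hψ0' : (0 : ℝ) < dedekindPsi n := by positivity
  have hyn : y ≤ n := by
    obtain ⟨p, hp⟩ := hSne
    have h1 : p ≤ n := Nat.le_of_dvd (Nat.pos_of_ne_zero hn0) (dvd_prod_of_mem _ hp)
    have h2 : (p : ℝ) ≤ n := by exact_mod_cast h1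
    nlinarith [(hS p hp).2.1]
  have htot : ((dedekindPsi n).totient : ℝ) / dedekindPsi n ≤
      ∏ p ∈ P.erase q₀, (1 - (p : ℝ)⁻¹) := by
    refine totient_div_le_prod_one_sub_inv hψ0 fun q hq => ⟨(hmem hq).1, ?_⟩
    rw [hψ]
    exact (hf q hq).2.1.trans (dvd_prod_of_mem (fun p => p + 1) (mem_image_of_mem f hq))
  have hratio : (dedekindPsi n : ℝ) / n ≤ Real.exp (1 / y) := by
    rw [hψ]
    refine (prod_add_one_div_prod_le (by positivity) fun p hp => (hS p hp).2.1).trans ?_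
    rw [Real.exp_le_exp, div_le_div_iff₀ (by positivity) hy0]
    nlinarith
  have hlogn : Real.log n ≤ y ^ (1 + 5 * δ) := by
    rw [hn, Nat.cast_prod, Real.log_prod fun p hp => by exact_mod_cast (hS p hp).1.ne_zero]
    calc ∑ p ∈ S, Real.log p ≤ #S • y ^ (5 * δ) := sum_le_card_nsmul _ _ _ fun p hp => (hS p hp).2.2
      _ ≤ y * y ^ (5 * δ) := by rw [nsmul_eq_mul]; gcongr
      _ = y ^ (1 + 5 * δ) := by rw [Real.rpow_add hy0, Real.rpow_one]
  have hlogn0 : 0 < Real.log n := Real.log_pos (by linarith)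
  have hloglog : Real.log (Real.log n) ≤ (1 + 5 * δ) * Real.log y := by
    rw [← Real.log_rpow hy0]
    exact Real.log_le_log hlogn0 hlogn
  have hlogy : 0 ≤ Real.log y := Real.log_nonneg (by linarith)
  have hprod0 : 0 ≤ ∏ p ∈ P, (1 - (p : ℝ)⁻¹) :=
    prod_nonneg fun p hp => by linarith [inv_prime_le_half (hP p hp)]
  refine ⟨n, hyn, ?_⟩
  calc _ = ((dedekindPsi n).totient : ℝ) / dedekindPsi n * (dedekindPsi n / n) *
        Real.log (Real.log n) := by field_simp
    _ ≤ ((dedekindPsi n).totient : ℝ) / dedekindPsi n * (dedekindPsi n / n) *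
        ((1 + 5 * δ) * Real.log y) := by gcongr
    _ ≤ ((1 + (Q : ℝ)⁻¹) * ∏ p ∈ P, (1 - (p : ℝ)⁻¹)) * Real.exp (1 / y) *
        ((1 + 5 * δ) * Real.log y) := by
      gcongr
      exact htot.trans (prod_erase_one_sub_inv_le hP hQ hq₀)
    _ = _ := by ring

theorem frequently_totient_dedekindPsi_mul_log_log_div_le {c : ℝ}
    (hc : Real.exp (-Real.eulerMascheroniConstant) < c) :
    ∃ᶠ n : ℕ in atTop, (dedekindPsi n).totient * Real.log (Real.log n) / n ≤ c := by
  have hinv : Tendsto (fun Q : ℕ => (Q : ℝ)⁻¹) atTop (𝓝 0) := tendsto_inv_atTop_nhds_zero_nat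
  have hlim : Tendsto (fun Q : ℕ => (1 : ℝ) * (1 + (Q : ℝ)⁻¹) * (1 + 5 * (Q : ℝ)⁻¹) *
      Real.exp (-Real.eulerMascheroniConstant)) atTop
      (𝓝 (1 * (1 + 0) * (1 + 5 * 0) * Real.exp (-Real.eulerMascheroniConstant))) :=
    (((hinv.const_add 1).const_mul 1).mul ((hinv.const_mul 5).const_add 1)).mul_const _
  obtain ⟨Q, hQc, hQ⟩ := ((hlim.eventually (gt_mem_nhds (by simpa using hc))).and
    (eventually_gt_atTop 0)).exists
  have hexp : Tendsto (fun y : ℝ => Real.exp (1 / y)) atTop (𝓝 1) := by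
    have h := (Real.continuous_exp.tendsto 0).comp tendsto_inv_atTop_zero
    simpa [Function.comp_def] using h
  have hy := (((hexp.mul_const (1 + (Q : ℝ)⁻¹)).mul_const (1 + 5 * (Q : ℝ)⁻¹)).mul
    tendsto_prod_one_sub_inv_prime_mul_log).eventually (gt_mem_nhds hQc)
  rw [frequently_atTop]
  intro N
  obtain ⟨y, ⟨n, hyn, hn⟩, hyc, hyN⟩ :=
    ((eventually_exists_totient_dedekindPsi_mul_log_log_div_le
      (inv_pos.mpr (Nat.cast_pos (α := ℝ).mpr hQ)) hQ).and
      (hy.and (eventually_ge_atTop (N : ℝ)))).exists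
  exact ⟨n, by exact_mod_cast hyN.trans hyn, hn.trans hyc.le⟩

end UpperBound

theorem liminf_phi_psi :
    liminf (fun n : ℕ => (Nat.totient (dedekindPsi n) : ℝ) * Real.log (Real.log n) / n) atTop
      = Real.exp (-Real.eulerMascheroniConstant) := by
  have hbdd : IsBoundedUnder (· ≥ ·) atTop
      fun n : ℕ => (Nat.totient (dedekindPsi n) : ℝ) * Real.log (Real.log n) / n :=
    ⟨0, eventually_map.mpr (eventually_le_totient_dedekindPsi_mul_log_log_div (Real.exp_pos _))⟩
  have hcobdd : IsCoboundedUnder (· ≥ ·) atTop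
      fun n : ℕ => (Nat.totient (dedekindPsi n) : ℝ) * Real.log (Real.log n) / n :=
    IsCoboundedUnder.of_frequently_le
      (frequently_totient_dedekindPsi_mul_log_log_div_le (lt_add_one _))
  refine le_antisymm (le_of_forall_gt_imp_ge_of_dense fun c hc => ?_)
    (le_of_forall_lt_imp_le_of_dense fun c hc => ?_)
  · exact liminf_le_of_frequently_le (frequently_totient_dedekindPsi_mul_log_log_div_le hc) hbdd
  · exact le_liminf_of_le hcobdd (eventually_le_totient_dedekindPsi_mul_log_log_div hc)
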